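/- arXiv:2003.08497 — 7 statements merged into one kernel-verified Lean document; each statement's English description precedes it below -/
import Mathlib

section
/- Let d be a graphical degree sequence of length n with M(d) > 2·J(d) + 6·Δ(d) + 2. Then d is (2,2)-stable; that is, |Ω(d')| ≤ M(d)² · |Ω(d)| for every graphical degree sequence d' of length n with ‖d' − d‖₁ ≤ 2. -/
open Finset

/-- The degree of vertex `i` in the simple graph `G`. -/
noncomputable def degOf {n : ℕ} (G : SimpleGraph (Fin n)) (i : Fin n) : ℕ :=
  (G.neighborSet i).ncard

/-- `Omega d` is the set of simple graphs on `{1,…,n}` with degree sequence `d`. -/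
def Omega {n : ℕ} (d : Fin n → ℕ) : Set (SimpleGraph (Fin n)) :=
  {G | ∀ i, degOf G i = d i}

/-- A degree sequence is graphical if it is realised by some simple graph. -/
def Graphical {n : ℕ} (d : Fin n → ℕ) : Prop := (Omega d).Nonempty

/-- `M(d)`, the sum of the entries of `d`. -/
def Mdeg {n : ℕ} (d : Fin n → ℕ) : ℕ := ∑ i, d i

/-- `Δ(d)`, the maximum entry of `d`. -/
def Δdeg {n : ℕ} (d : Fin n → ℕ) : ℕ := Finset.univ.sup d

/-- The sum of the `k` largest entries of `d`, expressed as the maximum of the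
sum of `d` over the subsets of size `k`. -/
def sumLargest {n : ℕ} (k : ℕ) (d : Fin n → ℕ) : ℕ :=
  (Finset.univ.powersetCard k).sup (fun S => ∑ i ∈ S, d i)

/-- `J(d)`, the sum of the `Δ(d)` largest entries of `d`. -/
def Jdeg {n : ℕ} (d : Fin n → ℕ) : ℕ := sumLargest (Δdeg d) d

/-- The ℓ₁ distance between two degree sequences. -/
def l1dist {n : ℕ} (d d' : Fin n → ℕ) : ℕ := ∑ i, ((d i : ℤ) - (d' i : ℤ)).natAbs

/-- A graphical degree sequence `d` is `(k,α)`-stable if `|Ω(d')| ≤ M(d)^α |Ω(d)|`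
for every graphical `d'` with `‖d' - d‖₁ ≤ k`. -/
def Stable {n : ℕ} (k : ℕ) (α : ℝ) (d : Fin n → ℕ) : Prop :=
  ∀ d' : Fin n → ℕ, Graphical d' → l1dist d' d ≤ k →
    ((Omega d').ncard : ℝ) ≤ (Mdeg d : ℝ) ^ α * ((Omega d).ncard : ℝ)

/-- `Ω'(d)`: union of `Ω(d')` over graphical `d' ≤ d` with `‖d - d'‖₁ ≤ 2`. -/
def OmegaPrime {n : ℕ} (d : Fin n → ℕ) : Set (SimpleGraph (Fin n)) :=
  ⋃ d' ∈ {d' : Fin n → ℕ | Graphical d' ∧ (∀ j, d' j ≤ d j) ∧ l1dist d d' ≤ 2},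
    Omega d'



open Classical in
lemma degOf_eq {n : ℕ} (G : SimpleGraph (Fin n)) (i : Fin n) : degOf G i = G.degree i := by
  unfold degOf
  rw [Set.ncard_eq_toFinset_card', ← SimpleGraph.card_neighborFinset_eq_degree]
  congr

lemma degOf_add {n : ℕ} (G : SimpleGraph (Fin n)) (u v w : Fin n) (huv : u ≠ v)
    (hn : ¬ G.Adj u v) :
    degOf (G ⊔ SimpleGraph.edge u v) w
      = degOf G w + ((if w = u then 1 else 0) + (if w = v then 1 else 0)) := by
  unfold degOf
  by_cases h1 : w = u
  · subst h1
    have : (G ⊔ SimpleGraph.edge w v).neighborSet w = insert v (G.neighborSet w) := by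
      ext x; simp [SimpleGraph.edge_adj]; grind
    rw [this, Set.ncard_insert_of_notMem (by simpa using hn) (Set.toFinite _)]
    simp [huv]
  · by_cases h2 : w = v
    · subst h2
      have : (G ⊔ SimpleGraph.edge u w).neighborSet w = insert u (G.neighborSet w) := by
        ext x; simp [SimpleGraph.edge_adj]; grind
      rw [this, Set.ncard_insert_of_notMem (by simpa [G.adj_comm] using hn) (Set.toFinite _)]
      simp [h1]
    · have : (G ⊔ SimpleGraph.edge u v).neighborSet w = G.neighborSet w := by
        ext x; simp [SimpleGraph.edge_adj]; grind
      rw [this]; simp [h1, h2]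

lemma degOf_sub {n : ℕ} (G : SimpleGraph (Fin n)) (u v w : Fin n) (hn : G.Adj u v) :
    degOf (G \ SimpleGraph.edge u v) w
      + ((if w = u then 1 else 0) + (if w = v then 1 else 0)) = degOf G w := by
  have h := degOf_add (G \ SimpleGraph.edge u v) u v w hn.ne
    (by simp [SimpleGraph.edge_adj, hn.ne])
  rw [← h]
  congr 1
  ext x y
  simp [SimpleGraph.edge_adj]
  have := hn.symm
  grind

open Classical in
lemma card_darts {n : ℕ} {d : Fin n → ℕ} {G : SimpleGraph (Fin n)} (hG : G ∈ Omega d)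
    (A : Finset (Fin n)) :
    #{p : Fin n × Fin n | G.Adj p.1 p.2 ∧ p.1 ∈ A} = ∑ i ∈ A, d i := by
  have : ({p : Fin n × Fin n | G.Adj p.1 p.2 ∧ p.1 ∈ A} : Finset _)
      = A.biUnion (fun i => (G.neighborFinset i).image (fun j => (i, j))) := by
    ext ⟨x, y⟩; simp; grind
  rw [this, Finset.card_biUnion]
  · refine Finset.sum_congr rfl fun i _ => ?_
    rw [Finset.card_image_of_injective _ (Prod.mk_right_injective i), ← hG i, degOf_eq]
    simp
  · intro i _ j _ hij
    rw [Function.onFun, Finset.disjoint_left]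
    simp; grind

open Classical in
lemma card_darts' {n : ℕ} {d : Fin n → ℕ} {G : SimpleGraph (Fin n)} (hG : G ∈ Omega d)
    (A : Finset (Fin n)) :
    #{p : Fin n × Fin n | G.Adj p.1 p.2 ∧ p.2 ∈ A} = ∑ i ∈ A, d i := by
  rw [← card_darts hG A]
  refine Finset.card_bij (fun p _ => (p.2, p.1)) ?_ ?_ ?_
  · simp; intro a b h1 h2; exact ⟨h1.symm, h2⟩
  · simp; grind
  · simp; intro a b h1 h2; exact ⟨h1.symm, h2⟩

open Classical in
lemma card_darts_univ {n : ℕ} {d : Fin n → ℕ} {G : SimpleGraph (Fin n)} (hG : G ∈ Omega d) :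
    #{p : Fin n × Fin n | G.Adj p.1 p.2} = Mdeg d := by
  have := card_darts hG univ
  simpa [Mdeg] using this

lemma exists_edge {n : ℕ} {d : Fin n → ℕ} {G : SimpleGraph (Fin n)} (hG : G ∈ Omega d)
    (A B : Finset (Fin n)) (h : ∑ i ∈ A, d i + ∑ i ∈ B, d i < Mdeg d) :
    ∃ a b, G.Adj a b ∧ a ∉ A ∧ b ∉ B := by
  classical
  by_contra! hc
  rw [← card_darts hG A, ← card_darts' hG B, ← card_darts_univ hG] at h
  refine absurd ((Finset.card_le_card ?_).trans (Finset.card_union_le _ _)) (not_le.mpr h)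
  intro p hp
  simp at hp ⊢
  have := hc p.1 p.2 hp
  grind

lemma even_M {n : ℕ} {d : Fin n → ℕ} (h : Graphical d) : Even (Mdeg d) := by
  classical
  obtain ⟨G, hG⟩ := h
  refine ⟨#G.edgeFinset, ?_⟩
  rw [← two_mul, ← G.sum_degrees_eq_twice_card_edges]
  unfold Mdeg
  refine Finset.sum_congr rfl fun i _ => ?_
  rw [← hG i, degOf_eq]

lemma le_Δ {n : ℕ} (d : Fin n → ℕ) (i : Fin n) : d i ≤ Δdeg d :=
  Finset.le_sup (f := d) (Finset.mem_univ i)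

lemma Δ_le {n : ℕ} {d : Fin n → ℕ} (h : Graphical d) : Δdeg d ≤ n := by
  classical
  obtain ⟨G, hG⟩ := h
  refine Finset.sup_le fun i _ => ?_
  rw [← hG i, degOf_eq]
  have := G.degree_lt_card_verts i
  simp at this; omega

lemma sum_le_J {n : ℕ} {d : Fin n → ℕ} (h : Graphical d) (k : ℕ) :
    ∀ S : Finset (Fin n), #S ≤ Δdeg d + k → ∑ i ∈ S, d i ≤ Jdeg d + k * Δdeg d := by
  induction k with
  | zero =>
    intro S hS
    obtain ⟨T, hST, hT⟩ := Finset.exists_superset_card_eq (s := S) (n := Δdeg d)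
      (by simpa using hS) (by simpa using Δ_le h)
    have h1 : ∑ i ∈ T, d i ≤ Jdeg d :=
      Finset.le_sup (f := fun S => ∑ i ∈ S, d i)
        (Finset.mem_powersetCard.mpr ⟨Finset.subset_univ T, hT⟩)
    have h2 := Finset.sum_le_sum_of_subset (f := d) hST
    omega
  | succ k ih =>
    intro S hS
    rcases S.eq_empty_or_nonempty with rfl | ⟨x, hx⟩
    · simp
    · have h1 := ih (S.erase x) (by rw [Finset.card_erase_of_mem hx]; omega)
      have h2 := Finset.add_sum_erase S d hx
      have h3 := le_Δ d x
      have : (k + 1) * Δdeg d = k * Δdeg d + Δdeg d := by ring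
      omega

lemma count {n : ℕ} {d d' : Fin n → ℕ}
    (dec : SimpleGraph (Fin n) → Fin n × Fin n → Fin n × Fin n → SimpleGraph (Fin n))
    (h : ∀ G ∈ Omega d', ∃ H ∈ Omega d, ∃ p q : Fin n × Fin n,
      H.Adj p.1 p.2 ∧ H.Adj q.1 q.2 ∧ G = dec H p q) :
    (Omega d').ncard ≤ Mdeg d ^ 2 * (Omega d).ncard := by
  classical
  rw [Set.ncard_eq_toFinset_card', Set.ncard_eq_toFinset_card']
  have hsub : (Omega d').toFinset ⊆ (Omega d).toFinset.biUnion (fun H =>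
      (({p : Fin n × Fin n | H.Adj p.1 p.2} : Finset _) ×ˢ
        ({p : Fin n × Fin n | H.Adj p.1 p.2} : Finset _)).image (fun r => dec H r.1 r.2)) := by
    intro G hG
    obtain ⟨H, hH, p, q, hp, hq, rfl⟩ := h G (by simpa using hG)
    simp only [Finset.mem_biUnion, Set.mem_toFinset, Finset.mem_image]
    exact ⟨H, hH, (p, q), by simp [hp, hq], rfl⟩
  refine (Finset.card_le_card hsub).trans ?_
  rw [mul_comm]
  refine Finset.card_biUnion_le_card_mul _ _ _ fun H hH => ?_
  refine Finset.card_image_le.trans ?_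
  rw [Finset.card_product, card_darts_univ (by simpa using hH), sq]

open Classical in
/-- Closed neighbourhood. -/
noncomputable def clN {n : ℕ} (G : SimpleGraph (Fin n)) (i : Fin n) : Finset (Fin n) :=
  insert i (G.neighborFinset i)

lemma mem_clN {n : ℕ} {G : SimpleGraph (Fin n)} {i x : Fin n} :
    x ∈ clN G i ↔ x = i ∨ G.Adj i x := by
  simp [clN]

lemma card_clN {n : ℕ} {d : Fin n → ℕ} {G : SimpleGraph (Fin n)} (hG : G ∈ Omega d) (i : Fin n) :
    #(clN G i) = d i + 1 := by
  classical
  unfold clN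
  rw [Finset.card_insert_of_notMem (by simp), SimpleGraph.card_neighborFinset_eq_degree,
    ← hG i, degOf_eq]

lemma exists_adj {n : ℕ} {d : Fin n → ℕ} {G : SimpleGraph (Fin n)} (hG : G ∈ Omega d) (i x : Fin n)
    (h : 1 ≤ d i ∧ x = i ∨ 2 ≤ d i) : ∃ a, G.Adj i a ∧ a ≠ x := by
  have h1 := card_clN hG i
  by_contra! hc
  have : clN G i ⊆ {i, x} := by
    intro y hy
    rw [mem_clN] at hy
    have := hc y
    simp; tauto
  have h2 := Finset.card_le_card this
  have h3 : #({i, x} : Finset (Fin n)) ≤ 2 := Finset.card_le_two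
  rcases h with ⟨h, rfl⟩ | h
  · simp at h2; omega
  · omega

/-- indicator -/
def ind {n : ℕ} (i : Fin n) (x : Fin n) : ℕ := if x = i then 1 else 0

lemma sum_ind_le {n : ℕ} (i : Fin n) (S : Finset (Fin n)) : ∑ x ∈ S, ind i x ≤ 1 := by
  unfold ind
  rw [Finset.sum_ite_eq']
  split_ifs <;> omega

lemma sum_ind {n : ℕ} (i : Fin n) : ∑ x, ind i x = 1 := by
  simp [ind]

lemma case2 {n : ℕ} {d d' : Fin n → ℕ} (hd : Graphical d)
    (h : Mdeg d > 2 * Jdeg d + 6 * Δdeg d + 2) (i j : Fin n)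
    (hdd : ∀ x, d x = d' x + ind i x + ind j x) :
    (Omega d').ncard ≤ Mdeg d ^ 2 * (Omega d).ncard := by
  refine count (fun H p q => ((H \ SimpleGraph.edge i p.2) \ SimpleGraph.edge j q.2) ⊔
    SimpleGraph.edge p.2 q.2) ?_
  intro G hG
  have hM : Mdeg d = Mdeg d' + 2 := by
    simp only [Mdeg, hdd, Finset.sum_add_distrib, sum_ind]
  have hle : ∀ S : Finset (Fin n), ∑ x ∈ S, d' x ≤ ∑ x ∈ S, d x := fun S =>
    Finset.sum_le_sum fun x _ => by rw [hdd x]; omega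
  have hi : d' i + 1 ≤ Δdeg d := by
    have := le_Δ d i; have := hdd i; simp [ind] at this; omega
  have hj : d' j + 1 ≤ Δdeg d := by
    have := le_Δ d j; have := hdd j; simp [ind] at this; omega
  have b1 := sum_le_J hd 0 (clN G i) (by rw [card_clN hG]; omega)
  have b2 := sum_le_J hd 0 (clN G j) (by rw [card_clN hG]; omega)
  obtain ⟨a, b, hab, ha, hb⟩ := exists_edge hG (clN G i) (clN G j) (by
    have := hle (clN G i); have := hle (clN G j); omega)
  rw [mem_clN] at ha hb
  push Not at ha hb
  have sm := G.adj_comm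
  have ne1 := hab.ne
  have e1 := fun x => degOf_sub G a b x hab
  have e2 := fun x => degOf_add (G \ SimpleGraph.edge a b) i a x ha.1.symm
    (by simp [ha.2])
  have e3 := fun x => degOf_add (G \ SimpleGraph.edge a b ⊔ SimpleGraph.edge i a) j b x hb.1.symm
    (by simp [SimpleGraph.edge_adj, hb.2]; grind)
  refine ⟨G \ SimpleGraph.edge a b ⊔ SimpleGraph.edge i a ⊔ SimpleGraph.edge j b, ?_,
    (i, a), (j, b), ?_, ?_, ?_⟩
  · intro x
    have e0 := hG x
    have := e1 x; have := e2 x; have := e3 x; have := hdd x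
    unfold ind at this
    omega
  · simp [SimpleGraph.edge_adj, ha.1.symm]
  · simp [SimpleGraph.edge_adj, hb.1.symm]
  · ext x y
    simp [SimpleGraph.edge_adj]
    grind

lemma case4 {n : ℕ} {d d' : Fin n → ℕ} (hd : Graphical d)
    (h : Mdeg d > 2 * Jdeg d + 6 * Δdeg d + 2) (i j : Fin n) (hij : i ≠ j)
    (hdd : ∀ x, d x + ind i x = d' x + ind j x) :
    (Omega d').ncard ≤ Mdeg d ^ 2 * (Omega d).ncard := by
  refine count (fun H p q => ((H \ SimpleGraph.edge p.1 p.2) \ SimpleGraph.edge q.1 q.2) ⊔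
    SimpleGraph.edge i p.1 ⊔ SimpleGraph.edge p.2 q.2) ?_
  intro G hG
  have hM : Mdeg d = Mdeg d' := by
    have := Finset.sum_congr (rfl : (univ : Finset (Fin n)) = univ) (fun x _ => hdd x)
    simp only [Finset.sum_add_distrib, sum_ind] at this
    simp only [Mdeg]; omega
  have hle : ∀ S : Finset (Fin n), ∑ x ∈ S, d' x ≤ ∑ x ∈ S, d x + 1 := fun S => by
    have h1 : ∑ x ∈ S, d' x ≤ ∑ x ∈ S, (d x + ind i x) :=
      Finset.sum_le_sum fun x _ => by rw [hdd x]; omega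
    rw [Finset.sum_add_distrib] at h1
    have := sum_ind_le i S
    omega
  have hi : 1 ≤ d' i := by
    have := hdd i; simp [ind, hij] at this; omega
  obtain ⟨a, hia, -⟩ := exists_adj hG i i (Or.inl ⟨hi, rfl⟩)
  have hj : d' j + 1 ≤ Δdeg d := by
    have := le_Δ d j; have := hdd j; simp [ind, hij.symm] at this; omega
  have ha : d' a ≤ Δdeg d := by
    have := le_Δ d a; have := hdd a; simp [ind, hia.ne.symm] at this; omega
  have b1 := sum_le_J hd 1 (clN G a) (by rw [card_clN hG]; omega)
  have b2 := sum_le_J hd 2 (insert a (insert i (clN G j))) (by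
    have h1 := Finset.card_insert_le a (insert i (clN G j))
    have h2 := Finset.card_insert_le i (clN G j)
    rw [card_clN hG] at h2; omega)
  obtain ⟨b, c, hbc, hb, hc⟩ := exists_edge hG (clN G a) (insert a (insert i (clN G j))) (by
    have := hle (clN G a); have := hle (insert a (insert i (clN G j))); omega)
  simp only [Finset.mem_insert, mem_clN] at hb hc
  push Not at hb hc
  obtain ⟨hba, hnab⟩ := hb
  obtain ⟨hca, hci, hcj, hnjc⟩ := hc
  have sm := G.adj_comm
  have ne1 := hia.ne
  have ne2 := hbc.ne
  have e1 := fun x => degOf_sub G i a x hia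
  have e2 := fun x => degOf_sub (G \ SimpleGraph.edge i a) b c x
    (by simp [SimpleGraph.edge_adj, hbc]; grind)
  have e3 := fun x => degOf_add ((G \ SimpleGraph.edge i a) \ SimpleGraph.edge b c) a b x hba.symm
    (by simp [hnab])
  have e4 := fun x => degOf_add ((G \ SimpleGraph.edge i a) \ SimpleGraph.edge b c ⊔
    SimpleGraph.edge a b) j c x hcj.symm
    (by simp [SimpleGraph.edge_adj, hnjc]; grind)
  refine ⟨(G \ SimpleGraph.edge i a) \ SimpleGraph.edge b c ⊔
      SimpleGraph.edge a b ⊔ SimpleGraph.edge j c, ?_, (a, b), (j, c), ?_, ?_, ?_⟩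
  · intro x
    have e0 := hG x
    have := e1 x; have := e2 x; have := e3 x; have := e4 x; have := hdd x
    unfold ind at this
    omega
  · simp [SimpleGraph.edge_adj, hba.symm]
  · simp [SimpleGraph.edge_adj, hcj.symm]
  · ext x y
    simp [SimpleGraph.edge_adj]
    grind

lemma case3 {n : ℕ} {d d' : Fin n → ℕ} (hd : Graphical d)
    (h : Mdeg d > 2 * Jdeg d + 6 * Δdeg d + 2) (i j : Fin n)
    (hdd : ∀ x, d' x = d x + ind i x + ind j x) :
    (Omega d').ncard ≤ Mdeg d ^ 2 * (Omega d).ncard := by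
  classical
  refine count (fun H p q => if p = q then H ⊔ SimpleGraph.edge i j else
    ((H \ SimpleGraph.edge p.1 p.2) \ SimpleGraph.edge q.1 q.2) ⊔
    SimpleGraph.edge i p.1 ⊔ SimpleGraph.edge j q.1 ⊔ SimpleGraph.edge p.2 q.2) ?_
  intro G hG
  have sm := G.adj_comm
  by_cases hadj : G.Adj i j
  · have e1 := fun x => degOf_sub G i j x hadj
    have hH : G \ SimpleGraph.edge i j ∈ Omega d := by
      intro x
      have e0 := hG x
      have := e1 x; have := hdd x
      unfold ind at this
      omega
    obtain ⟨a, b, hab, -, -⟩ := exists_edge hH ∅ ∅ (by simp; omega)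
    refine ⟨_, hH, (a, b), (a, b), hab, hab, ?_⟩
    simp only [if_true]
    ext x y
    simp [SimpleGraph.edge_adj]
    grind
  have hM : Mdeg d' = Mdeg d + 2 := by
    simp only [Mdeg, hdd, Finset.sum_add_distrib, sum_ind]
  have hle : ∀ S : Finset (Fin n), ∑ x ∈ S, d' x ≤ ∑ x ∈ S, d x + 2 := fun S => by
    simp only [hdd, Finset.sum_add_distrib]
    have := sum_ind_le i S
    have := sum_ind_le j S
    omega
  have hi : 1 ≤ d' i := by
    have := hdd i; simp [ind] at this; omega
  obtain ⟨a, hia, -⟩ := exists_adj hG i i (Or.inl ⟨hi, rfl⟩)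
  have hj : ∃ b, G.Adj j b ∧ (i = j → b ≠ a) := by
    have := hdd j
    by_cases hij : i = j
    · subst hij
      simp [ind] at this
      obtain ⟨b, hb, hba⟩ := exists_adj hG i a (Or.inr (by omega))
      exact ⟨b, hb, fun _ => hba⟩
    · simp [ind] at this
      obtain ⟨b, hb, -⟩ := exists_adj hG j j (Or.inl ⟨by omega, rfl⟩)
      exact ⟨b, hb, fun h => absurd h hij⟩
  obtain ⟨b, hjb, hab⟩ := hj
  have haj : a ≠ j := by rintro rfl; exact hadj hia
  have hbi : b ≠ i := by rintro rfl; exact hadj hjb.symm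
  have ha : d' a ≤ Δdeg d := by
    have := le_Δ d a; have := hdd a; simp [ind, hia.ne.symm, haj] at this; omega
  have hb : d' b ≤ Δdeg d := by
    have := le_Δ d b; have := hdd b; simp [ind, hjb.ne.symm, hbi] at this; omega
  have b1 := sum_le_J hd 1 (clN G a) (by rw [card_clN hG]; omega)
  have b2 := sum_le_J hd 1 (clN G b) (by rw [card_clN hG]; omega)
  obtain ⟨c, e, hce, hc, he⟩ := exists_edge hG (clN G a) (clN G b) (by
    have := hle (clN G a); have := hle (clN G b); omega)
  simp only [mem_clN] at hc he
  push Not at hc he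
  obtain ⟨hca, hnac⟩ := hc
  obtain ⟨heb, hnbe⟩ := he
  have ne1 := hia.ne
  have ne2 := hjb.ne
  have ne3 := hce.ne
  have e1 := fun x => degOf_sub G i a x hia
  have e2 := fun x => degOf_sub (G \ SimpleGraph.edge i a) j b x
    (by simp [SimpleGraph.edge_adj, hjb]; grind)
  have e3 := fun x => degOf_sub ((G \ SimpleGraph.edge i a) \ SimpleGraph.edge j b) c e x
    (by simp [SimpleGraph.edge_adj, hce]; grind)
  have e4 := fun x => degOf_add (((G \ SimpleGraph.edge i a) \ SimpleGraph.edge j b) \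
    SimpleGraph.edge c e) a c x hca.symm
    (by simp [hnac])
  have e5 := fun x => degOf_add (((G \ SimpleGraph.edge i a) \ SimpleGraph.edge j b) \
    SimpleGraph.edge c e ⊔ SimpleGraph.edge a c) b e x heb.symm
    (by simp [SimpleGraph.edge_adj, hnbe]; grind)
  refine ⟨((G \ SimpleGraph.edge i a) \ SimpleGraph.edge j b) \
    SimpleGraph.edge c e ⊔ SimpleGraph.edge a c ⊔ SimpleGraph.edge b e,
    ?_, (a, c), (b, e), ?_, ?_, ?_⟩
  · intro x
    have e0 := hG x
    have := e1 x; have := e2 x; have := e3 x; have := e4 x; have := e5 x; have := hdd x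
    unfold ind at this
    omega
  · simp [SimpleGraph.edge_adj, hca.symm]
  · simp [SimpleGraph.edge_adj, heb.symm]
  · rw [if_neg (by simp; grind)]
    ext x y
    simp [SimpleGraph.edge_adj]
    grind

lemma sum_succ {n : ℕ} {f : Fin n → ℕ} {k : ℕ} (h : ∑ x, f x = k + 1) :
    ∃ i, ∃ g : Fin n → ℕ, (∀ x, f x = g x + ind i x) ∧ ∑ x, g x = k := by
  have : ∃ i, f i ≠ 0 := by
    by_contra! hc
    simp [hc] at h
  obtain ⟨i, hi⟩ := this
  have hf : ∀ x, f x = (f x - ind i x) + ind i x := by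
    intro x; unfold ind; split_ifs with hx
    · subst hx; omega
    · omega
  refine ⟨i, fun x => f x - ind i x, hf, ?_⟩
  rw [Finset.sum_congr rfl (fun x _ => hf x), Finset.sum_add_distrib, sum_ind] at h
  exact Nat.succ.inj h

lemma sum_zero' {n : ℕ} {f : Fin n → ℕ} (h : ∑ x, f x = 0) (x : Fin n) : f x = 0 := by
  simpa using (Finset.sum_eq_zero_iff.mp h) x (Finset.mem_univ x)

lemma main_nat {n : ℕ} (d : Fin n → ℕ) (hd : Graphical d)
    (h : Mdeg d > 2 * Jdeg d + 6 * Δdeg d + 2) (d' : Fin n → ℕ) (hd' : Graphical d')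
    (hl : l1dist d' d ≤ 2) : (Omega d').ncard ≤ Mdeg d ^ 2 * (Omega d).ncard := by
  have hl' : l1dist d' d = ∑ x, (d' x - d x) + ∑ x, (d x - d' x) := by
    rw [← Finset.sum_add_distrib]
    exact Finset.sum_congr rfl fun x _ => by omega
  have hMM : Mdeg d + ∑ x, (d' x - d x) = Mdeg d' + ∑ x, (d x - d' x) := by
    simp only [Mdeg, ← Finset.sum_add_distrib]
    exact Finset.sum_congr rfl fun x _ => by omega
  obtain ⟨m, hm⟩ := even_M hd
  obtain ⟨m', hm'⟩ := even_M hd'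
  have hcases : (∑ x, (d' x - d x) = 0 ∧ ∑ x, (d x - d' x) = 0) ∨
      (∑ x, (d' x - d x) = 0 ∧ ∑ x, (d x - d' x) = 2) ∨
      (∑ x, (d' x - d x) = 2 ∧ ∑ x, (d x - d' x) = 0) ∨
      (∑ x, (d' x - d x) = 1 ∧ ∑ x, (d x - d' x) = 1) := by omega
  rcases hcases with ⟨hp, hn⟩ | ⟨hp, hn⟩ | ⟨hp, hn⟩ | ⟨hp, hn⟩
  · have : d' = d := by
      funext x
      have := sum_zero' hp x; have := sum_zero' hn x; omega
    subst this
    exact Nat.le_mul_of_pos_left _ (pow_pos (by omega) 2)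
  · obtain ⟨i, g, hg, hg1⟩ := sum_succ hn
    obtain ⟨j, g', hg', hg2⟩ := sum_succ hg1
    refine case2 hd h i j fun x => ?_
    have := sum_zero' hp x; have := sum_zero' hg2 x; have := hg x; have := hg' x
    omega
  · obtain ⟨i, g, hg, hg1⟩ := sum_succ hp
    obtain ⟨j, g', hg', hg2⟩ := sum_succ hg1
    refine case3 hd h i j fun x => ?_
    have := sum_zero' hn x; have := sum_zero' hg2 x; have := hg x; have := hg' x
    omega
  · obtain ⟨i, g, hg, hg1⟩ := sum_succ hp
    obtain ⟨j, g', hg', hg2⟩ := sum_succ hn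
    refine case4 hd h i j ?_ fun x => ?_
    · rintro rfl
      have := hg i; have := hg' i
      simp [ind] at *
      omega
    · have := sum_zero' hg1 x; have := sum_zero' hg2 x; have := hg x; have := hg' x
      omega



/-- Theorem 3.4 / `thm:main`: if `M(d) > 2J(d) + 6Δ(d) + 2`
then `d` is `(2,2)`-stable. -/
theorem stmt_0 {n : ℕ} (d : Fin n → ℕ) (hd : Graphical d)
    (h : Mdeg d > 2 * Jdeg d + 6 * Δdeg d + 2) :
    Stable 2 2 d := by
  intro d' hd' hl
  have := main_nat d hd h d' hd' hl
  rw [Real.rpow_two]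
  exact_mod_cast this
end

section
/- Let D be a set of nontrivial graphical degree sequences (of varying lengths). Then D is P-stable (there exist constants C > 0 and t > 0 such that |Ω'(d)| ≤ C·n^t·|Ω(d)| for every d ∈ D of length n) if and only if D is 2-stable (there exists a constant α > 0 such that every d ∈ D is (2,α)-stable). -/
open Finset

/-- graphs close to `d` with excess at most `k` -/
def AEx {n : ℕ} (d : Fin n → ℕ) (k : ℕ) : Set (SimpleGraph (Fin n)) :=
  {G | l1dist (degOf G) d ≤ 2 ∧ ∑ i, (degOf G i - d i) ≤ k}

lemma l1dist_comm' {n : ℕ} (d d' : Fin n → ℕ) : l1dist d d' = l1dist d' d := by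
  unfold l1dist
  refine Finset.sum_congr rfl fun i _ => ?_
  omega

lemma AEx_zero {n : ℕ} (d : Fin n → ℕ) : AEx d 0 ⊆ OmegaPrime d := by
  rintro G ⟨h1, h2⟩
  simp only [OmegaPrime, Set.mem_iUnion]
  refine ⟨degOf G, ⟨⟨G, fun i => rfl⟩, ?_, ?_⟩, fun i => rfl⟩
  · intro j
    have := Finset.single_le_sum (f := fun i => degOf G i - d i) (fun i _ => Nat.zero_le _)
      (Finset.mem_univ j)
    beta_reduce at this
    omega
  · rw [l1dist_comm']; exact h1

lemma sum_split2 {n : ℕ} {β : Type*} [AddCommMonoid β] (f : Fin n → β) {i a : Fin n} (h : i ≠ a) :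
    ∑ j, f j = f i + (f a + ∑ j ∈ (Finset.univ.erase i).erase a, f j) := by
  rw [Finset.add_sum_erase _ _ (by simp [h.symm]), Finset.add_sum_erase _ _ (by simp)]

lemma degOf_del {n : ℕ} (G : SimpleGraph (Fin n)) {i a : Fin n} (h : G.Adj i a) :
    degOf (G.deleteEdges {s(i,a)}) i + 1 = degOf G i := by
  unfold degOf
  have : (G.deleteEdges {s(i,a)}).neighborSet i = G.neighborSet i \ {a} := by
    ext b
    simp [SimpleGraph.deleteEdges_adj]
    intro _
    have := h.ne
    grind
  rw [this]
  exact Set.ncard_sdiff_singleton_add_one (by simpa using h) (Set.toFinite _)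

lemma degOf_del_other {n : ℕ} (G : SimpleGraph (Fin n)) {i a j : Fin n} (hi : j ≠ i) (ha : j ≠ a) :
    degOf (G.deleteEdges {s(i,a)}) j = degOf G j := by
  unfold degOf
  have : (G.deleteEdges {s(i,a)}).neighborSet j = G.neighborSet j := by
    ext b
    simp [SimpleGraph.deleteEdges_adj]
    grind
  rw [this]

lemma AEx_succ {n : ℕ} (hn : 0 < n) (d : Fin n → ℕ) (k : ℕ) :
    AEx d (k+1) ⊆ (fun p : SimpleGraph (Fin n) × (Fin n × Fin n) =>
      p.1 ⊔ SimpleGraph.edge p.2.1 p.2.2) '' (AEx d k ×ˢ Set.univ) := by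
  rintro G ⟨h1, h2⟩
  by_cases hk : ∑ i, (degOf G i - d i) ≤ k
  · refine ⟨(G, (⟨0, hn⟩, ⟨0, hn⟩)), ⟨⟨h1, hk⟩, trivial⟩, ?_⟩
    simp
  · have : ∃ i, d i < degOf G i := by
      by_contra! hc
      apply hk
      rw [Finset.sum_eq_zero]
      · omega
      · intro i _
        have := hc i
        omega
    obtain ⟨i, hi⟩ := this
    have hne : (G.neighborSet i).Nonempty := by
      apply Set.nonempty_of_ncard_ne_zero
      unfold degOf at hi
      omega
    obtain ⟨a, ha⟩ := hne
    have ha : G.Adj i a := ha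
    have hia := ha.ne
    have e1 := degOf_del G ha
    have e2 := degOf_del G ha.symm
    rw [Sym2.eq_swap] at e2
    have hrest : ∀ j ∈ (Finset.univ.erase i).erase a,
        degOf (G.deleteEdges {s(i,a)}) j = degOf G j := by
      intro j hj
      simp at hj
      exact degOf_del_other G hj.2 hj.1
    refine ⟨(G.deleteEdges {s(i,a)}, (i, a)), ⟨⟨?_, ?_⟩, trivial⟩, ?_⟩
    · unfold l1dist at h1 ⊢
      rw [sum_split2 _ hia] at h1 ⊢
      rw [Finset.sum_congr rfl (fun j hj => by rw [hrest j hj])]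
      simp only at h1 ⊢
      omega
    · rw [sum_split2 _ hia] at h2 ⊢
      rw [Finset.sum_congr rfl (fun j hj => by rw [hrest j hj])]
      simp only at h2 ⊢
      omega
    · ext u v
      simp [SimpleGraph.deleteEdges_adj, SimpleGraph.edge_adj]
      have := ha.symm
      grind

lemma AEx_card {n : ℕ} (hn : 0 < n) (d : Fin n → ℕ) (k : ℕ) :
    (AEx d (k+1)).ncard ≤ (AEx d k).ncard * (n * n) := by
  refine (Set.ncard_le_ncard (AEx_succ hn d k) (Set.toFinite _)).trans ?_
  refine (Set.ncard_image_le (Set.toFinite _)).trans ?_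
  rw [Set.ncard_prod]
  simp [Set.ncard_univ]

lemma Omega_le {n : ℕ} (hn : 0 < n) (d d' : Fin n → ℕ) (h : l1dist d' d ≤ 2) :
    (Omega d').ncard ≤ (OmegaPrime d).ncard * n ^ 4 := by
  have h1 : Omega d' ⊆ AEx d 2 := by
    intro G hG
    have : degOf G = d' := funext hG
    refine ⟨by rw [this]; exact h, ?_⟩
    rw [this]
    refine le_trans (Finset.sum_le_sum fun i _ => ?_) h
    omega
  have h2 := Set.ncard_le_ncard h1 (Set.toFinite _)
  have h3 := AEx_card hn d 1
  have h4 := AEx_card hn d 0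
  have h5 := Set.ncard_le_ncard (AEx_zero d) (Set.toFinite _)
  calc _ ≤ _ := h2
    _ ≤ _ := h3
    _ ≤ ((OmegaPrime d).ncard * (n * n)) * (n * n) := by
      refine Nat.mul_le_mul_right _ (h4.trans (Nat.mul_le_mul_right _ h5))
    _ = _ := by ring

/-- lower one coordinate -/
def lowr {n : ℕ} (d : Fin n → ℕ) : Option (Fin n) → (Fin n → ℕ)
  | none => d
  | some i => fun j => if j = i then d j - 1 else d j

lemma lowr_step {n : ℕ} (k : ℕ) (d d' : Fin n → ℕ) (h : ∀ j, d' j ≤ d j)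
    (hs : ∑ j, (d j - d' j) ≤ k + 1) :
    ∃ o, (∀ j, d' j ≤ lowr d o j) ∧ ∑ j, (lowr d o j - d' j) ≤ k := by
  by_cases hk : ∑ i, (d i - d' i) ≤ k
  · exact ⟨none, h, hk⟩
  · have : ∃ i, d' i < d i := by
      by_contra! hc
      apply hk
      rw [Finset.sum_eq_zero]
      · omega
      · intro i _
        have := hc i
        omega
    obtain ⟨i, hi⟩ := this
    refine ⟨some i, ?_, ?_⟩
    · intro j
      have := h j
      simp only [lowr]
      split_ifs with hj
      · subst hj; omega
      · exact this
    · rw [← Finset.add_sum_erase _ _ (Finset.mem_univ i)] at hs ⊢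
      have : ∀ j ∈ Finset.univ.erase i, lowr d (some i) j - d' j = d j - d' j := by
        intro j hj
        simp at hj
        simp [lowr, hj]
      rw [Finset.sum_congr rfl this]
      simp only [lowr, if_true]
      omega

lemma below_card {n : ℕ} (d : Fin n → ℕ) :
    {d' : Fin n → ℕ | Graphical d' ∧ (∀ j, d' j ≤ d j) ∧ l1dist d d' ≤ 2} ⊆
      Set.range (fun p : Option (Fin n) × Option (Fin n) => lowr (lowr d p.1) p.2) := by
  rintro d' ⟨-, h1, h2⟩
  have hs : ∑ j, (d j - d' j) ≤ 1 + 1 := by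
    refine le_trans (Finset.sum_le_sum fun i _ => ?_) h2
    omega
  obtain ⟨o1, a1, b1⟩ := lowr_step 1 d d' h1 hs
  obtain ⟨o2, a2, b2⟩ := lowr_step 0 _ d' a1 b1
  refine ⟨(o1, o2), ?_⟩
  funext j
  have := Finset.single_le_sum (f := fun j => lowr (lowr d o1) o2 j - d' j)
    (fun i _ => Nat.zero_le _) (Finset.mem_univ j)
  have h3 := a2 j
  simp only at this ⊢
  omega

lemma OmegaPrime_le {n : ℕ} (d : Fin n → ℕ) (B : ℕ)
    (hB : ∀ d' : Fin n → ℕ, Graphical d' → l1dist d' d ≤ 2 → (Omega d').ncard ≤ B) :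
    (OmegaPrime d).ncard ≤ (n + 1) ^ 2 * B := by
  classical
  set S := {d' : Fin n → ℕ | Graphical d' ∧ (∀ j, d' j ≤ d j) ∧ l1dist d d' ≤ 2} with hS
  have hfin : S.Finite := (Set.finite_range _).subset (below_card d)
  have hcard : hfin.toFinset.card ≤ (n+1)^2 := by
    rw [← Set.ncard_eq_toFinset_card S hfin]
    refine (Set.ncard_le_ncard (below_card d) (Set.finite_range _)).trans ?_
    rw [← Set.image_univ]
    refine (Set.ncard_image_le (Set.toFinite _)).trans ?_
    simp [Set.ncard_univ, sq]
  have heq : OmegaPrime d =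
      ((hfin.toFinset.biUnion fun d' => (Set.toFinite (Omega d')).toFinset : Finset _) :
        Set (SimpleGraph (Fin n))) := by
    ext G
    simp [OmegaPrime, hS]
  rw [heq, Set.ncard_coe_finset]
  refine (Finset.card_biUnion_le_card_mul _ _ B ?_).trans (Nat.mul_le_mul_right _ hcard)
  intro d' hd'
  rw [← Set.ncard_eq_toFinset_card]
  rw [Set.Finite.mem_toFinset] at hd'
  exact hB d' hd'.1 (by rw [l1dist_comm']; exact hd'.2.2)

lemma degOf_lt {n : ℕ} (G : SimpleGraph (Fin n)) (i : Fin n) : degOf G i < n := by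
  unfold degOf
  have h : (G.neighborSet i) ⊂ Set.univ := by
    rw [Set.ssubset_univ_iff]
    intro h
    have : i ∈ G.neighborSet i := by rw [h]; trivial
    simp at this
  have := Set.ncard_lt_ncard h (Set.toFinite _)
  simpa [Set.ncard_univ] using this

lemma Omega_sub {n : ℕ} (d : Fin n → ℕ) (h : Graphical d) : Omega d ⊆ OmegaPrime d := by
  intro G hG
  simp only [OmegaPrime, Set.mem_iUnion]
  exact ⟨d, ⟨h, fun _ => le_rfl, by simp [l1dist]⟩, hG⟩

theorem stmt_3 (D : (n : ℕ) → Set (Fin n → ℕ))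
    (hD : ∀ n, ∀ d ∈ D n, Graphical d ∧ ∀ i, 1 ≤ d i) :
    (∃ C > (0 : ℝ), ∃ t > (0 : ℝ), ∀ n, ∀ d ∈ D n,
        ((OmegaPrime d).ncard : ℝ) ≤ C * (n : ℝ) ^ t * ((Omega d).ncard : ℝ))
      ↔ (∃ α > (0 : ℝ), ∀ n, ∀ d ∈ D n, Stable 2 α d) := by
  constructor
  · rintro ⟨C, hC, t, ht, H⟩
    obtain ⟨s, hs⟩ := pow_unbounded_of_one_lt C (one_lt_two (α := ℝ))
    refine ⟨s + t + 4, by positivity, ?_⟩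
    intro n d hd d' hd' hdist
    obtain ⟨hg, hpos⟩ := hD n d hd
    have h := H n d hd
    rcases Nat.eq_zero_or_pos n with rfl | hn
    · exfalso
      simp only [Nat.cast_zero, Real.zero_rpow ht.ne', mul_zero, zero_mul] at h
      have h1 : (OmegaPrime d).ncard = 0 := by
        exact_mod_cast le_antisymm h (Nat.cast_nonneg _)
      rw [Set.ncard_eq_zero (Set.toFinite _)] at h1
      obtain ⟨G, hG⟩ := hg
      have := Omega_sub d ⟨G, hG⟩ hG
      rw [h1] at this
      exact this
    · have hn2 : 2 ≤ n := by
        obtain ⟨G, hG⟩ := hg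
        have h1 := degOf_lt G ⟨0, hn⟩
        have h2 := hG ⟨0, hn⟩
        have h3 := hpos ⟨0, hn⟩
        omega
      have hM : n ≤ Mdeg d := by
        have := Finset.sum_le_sum (s := Finset.univ) fun i _ => hpos i
        simpa [Mdeg] using this
      have hMR : (n : ℝ) ≤ Mdeg d := by exact_mod_cast hM
      have hM2 : (2 : ℝ) ≤ Mdeg d := by exact_mod_cast hn2.trans hM
      have hM0 : (0 : ℝ) < Mdeg d := by linarith
      have h1 : ((Omega d').ncard : ℝ) ≤ (OmegaPrime d).ncard * (n : ℝ) ^ 4 := by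
        exact_mod_cast Omega_le hn d d' hdist
      have e : (Mdeg d : ℝ) ^ ((s : ℝ) + t + 4) =
          (Mdeg d : ℝ) ^ s * (Mdeg d : ℝ) ^ t * (Mdeg d : ℝ) ^ 4 := by
        rw [Real.rpow_add hM0, Real.rpow_add hM0, Real.rpow_natCast]
        congr 1
        exact Real.rpow_ofNat _ 4
      rw [e]
      calc _ ≤ _ := h1
        _ ≤ (C * (n : ℝ) ^ t * ((Omega d).ncard : ℝ)) * (n : ℝ) ^ 4 := by gcongr
        _ = C * (n : ℝ) ^ t * (n : ℝ) ^ 4 * ((Omega d).ncard : ℝ) := by ring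
        _ ≤ _ := by
          have : C ≤ (Mdeg d : ℝ) ^ s := hs.le.trans (by gcongr)
          gcongr
  · rintro ⟨α, hα, H⟩
    refine ⟨4, by norm_num, 2 * α + 2, by positivity, ?_⟩
    intro n d hd
    obtain ⟨hg, hpos⟩ := hD n d hd
    have h := H n d hd
    have hne : (Omega d).ncard ≠ 0 := by
      rw [Ne, Set.ncard_eq_zero (Set.toFinite _)]
      exact hg.ne_empty
    rcases Nat.eq_zero_or_pos n with rfl | hn
    · exfalso
      have := h d hg (by simp [l1dist])
      have hM : Mdeg d = 0 := by simp [Mdeg]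
      rw [hM, Nat.cast_zero, Real.zero_rpow hα.ne', zero_mul] at this
      apply hne
      exact_mod_cast le_antisymm this (Nat.cast_nonneg _)
    · have hnR : (1 : ℝ) ≤ n := by exact_mod_cast hn
      have hn0 : (0 : ℝ) < n := by linarith
      have hM : Mdeg d ≤ n ^ 2 := by
        obtain ⟨G, hG⟩ := hg
        have : ∑ i, d i ≤ ∑ i : Fin n, n :=
          Finset.sum_le_sum fun i _ => by rw [← hG i]; exact (degOf_lt G i).le
        simpa [Mdeg, sq] using this
      have hMR : (Mdeg d : ℝ) ≤ (n : ℝ) ^ 2 := by exact_mod_cast hM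
      set X : ℝ := (Mdeg d : ℝ) ^ α * ((Omega d).ncard : ℝ) with hX
      have hX0 : 0 ≤ X := by positivity
      have h1 := OmegaPrime_le d ⌊X⌋₊ (fun d' hd' hl => Nat.le_floor (h d' hd' hl))
      have h2 : ((OmegaPrime d).ncard : ℝ) ≤ ((n : ℝ) + 1) ^ 2 * (⌊X⌋₊ : ℝ) := by
        exact_mod_cast h1
      have e : (n : ℝ) ^ (2 * α + 2) = ((n : ℝ) ^ 2) ^ α * (n : ℝ) ^ 2 := by
        rw [Real.rpow_add hn0, Real.rpow_mul hn0.le]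
        norm_num
      rw [e]
      calc _ ≤ _ := h2
        _ ≤ ((n : ℝ) + n) ^ 2 * X := by
          gcongr
          exact Nat.floor_le hX0
        _ ≤ ((n : ℝ) + n) ^ 2 * (((n : ℝ) ^ 2) ^ α * ((Omega d).ncard : ℝ)) := by
          rw [hX]; gcongr
        _ = _ := by ring
end

section
/- Let G be a simple graph on vertex set {1,…,n} with degree sequence d, and let v be any vertex of G. Then the number of ordered triples (a,b,c) of pairwise distinct vertices with a = v such that ab and bc are both edges of G is at most J(d) − Δ(d). -/
open Finset

/-- inequality (10), `2paths`: in a graph `G` with degree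
sequence `d`, the number of directed 2-paths starting at any vertex `v` is at
most `J(d) - Δ(d)`. -/
theorem stmt_6 {n : ℕ} (d : Fin n → ℕ) (G : SimpleGraph (Fin n))
    (hG : G ∈ Omega d) (v : Fin n) :
    ({t : Fin n × Fin n × Fin n |
        t.1 = v ∧ t.1 ≠ t.2.1 ∧ t.2.1 ≠ t.2.2 ∧ t.1 ≠ t.2.2 ∧
        G.Adj t.1 t.2.1 ∧ G.Adj t.2.1 t.2.2}.ncard)
      ≤ Jdeg d - Δdeg d := by
  classical
  have hdeg : ∀ i, G.degree i = d i := by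
    intro i
    rw [← hG i, degOf, ← SimpleGraph.card_neighborFinset_eq_degree,
      ← Set.ncard_coe_finset, SimpleGraph.coe_neighborFinset]
  have hpos : ∀ i j, G.Adj i j → 1 ≤ d j := by
    intro i j h
    rw [← hdeg j]
    exact (G.degree_pos_iff_exists_adj j).2 ⟨i, h.symm⟩
  have hsub : ∀ i, G.neighborFinset i ⊆ Finset.univ.filter (fun j => 1 ≤ d j) := by
    intro i j hj
    rw [SimpleGraph.mem_neighborFinset] at hj
    simpa using hpos i j hj
  have h1 : (G.neighborFinset v).card ≤ Δdeg d := by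
    rw [SimpleGraph.card_neighborFinset_eq_degree, hdeg]
    exact Finset.le_sup (f := d) (Finset.mem_univ v)
  have h2 : Δdeg d ≤ (Finset.univ.filter (fun j => 1 ≤ d j)).card := by
    refine Finset.sup_le fun i _ => ?_
    rw [← hdeg i, ← SimpleGraph.card_neighborFinset_eq_degree]
    exact Finset.card_le_card (hsub i)
  obtain ⟨S, hNS, hSP, hS⟩ := Finset.exists_subsuperset_card_eq (hsub v) h1 h2
  have hJ : ∑ i ∈ S, d i ≤ Jdeg d := by
    unfold Jdeg sumLargest
    exact Finset.le_sup (f := fun S => ∑ i ∈ S, d i)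
      (Finset.mem_powersetCard.2 ⟨Finset.subset_univ S, hS⟩)
  have hsum : ∑ i ∈ S, (d i - 1) + Δdeg d = ∑ i ∈ S, d i := by
    rw [← hS, Finset.card_eq_sum_ones, ← Finset.sum_add_distrib]
    refine Finset.sum_congr rfl fun i hi => ?_
    have := (Finset.mem_filter.1 (hSP hi)).2
    omega
  have hle : ∑ i ∈ G.neighborFinset v, (d i - 1) ≤ ∑ i ∈ S, (d i - 1) :=
    Finset.sum_le_sum_of_subset hNS
  have hcount : ({t : Fin n × Fin n × Fin n |
        t.1 = v ∧ t.1 ≠ t.2.1 ∧ t.2.1 ≠ t.2.2 ∧ t.1 ≠ t.2.2 ∧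
        G.Adj t.1 t.2.1 ∧ G.Adj t.2.1 t.2.2}.ncard) ≤
      ∑ i ∈ G.neighborFinset v, (d i - 1) := by
    let T : Finset (Fin n × Fin n × Fin n) :=
      (G.neighborFinset v).biUnion fun b =>
        ((G.neighborFinset b).erase v).image fun c => (v, b, c)
    have hT : T.card ≤ ∑ i ∈ G.neighborFinset v, (d i - 1) := by
      refine Finset.card_biUnion_le.trans (Finset.sum_le_sum fun b hb => ?_)
      refine Finset.card_image_le.trans ?_
      rw [SimpleGraph.mem_neighborFinset] at hb
      rw [Finset.card_erase_of_mem (by simpa using hb.symm),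
        SimpleGraph.card_neighborFinset_eq_degree, hdeg]
    refine le_trans ?_ hT
    rw [← Set.ncard_coe_finset]
    refine Set.ncard_le_ncard ?_ (Finset.finite_toSet T)
    rintro ⟨a, b, c⟩ ⟨h1, _, _, h4, h5, h6⟩
    dsimp only at h1 h4 h5 h6
    subst h1
    simp only [T, Finset.mem_coe, Finset.mem_biUnion, Finset.mem_image, Finset.mem_erase,
      SimpleGraph.mem_neighborFinset]
    exact ⟨b, h5, c, ⟨h4.symm, h6⟩, rfl⟩
  omega
end

section
/- Let d be a degree sequence of length n with Δ(d) ≤ n (in particular, this holds for any graphical d). Then J(d)² ≤ Δ(d) · (M(d) + M₂(d)). -/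
open Finset

/-- `M₂(d) = ∑ᵢ dᵢ(dᵢ - 1)`. -/
def M2deg {n : ℕ} (d : Fin n → ℕ) : ℕ := ∑ i, d i * (d i - 1)

/-- Cauchy–Schwarz step in Theorem 5.1: if `Δ(d) ≤ n` then
`J(d)² ≤ Δ(d)(M(d) + M₂(d))`. -/
theorem stmt_7 {n : ℕ} (d : Fin n → ℕ) (h : Δdeg d ≤ n) :
    Jdeg d ^ 2 ≤ Δdeg d * (Mdeg d + M2deg d) := by
  have hM : Mdeg d + M2deg d = ∑ i, d i ^ 2 := by
    unfold Mdeg M2deg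
    rw [← Finset.sum_add_distrib]
    refine Finset.sum_congr rfl fun i _ => ?_
    cases d i with
    | zero => rfl
    | succ k => simp only [Nat.add_sub_cancel]; ring
  have hne : ((Finset.univ : Finset (Fin n)).powersetCard (Δdeg d)).Nonempty :=
    Finset.powersetCard_nonempty.2 (by simpa using h)
  obtain ⟨S, hS, hJ⟩ := Finset.exists_mem_eq_sup _ hne (fun S => ∑ i ∈ S, d i)
  have hJ' : Jdeg d = ∑ i ∈ S, d i := hJ
  have hc : S.card = Δdeg d := (Finset.mem_powersetCard.1 hS).2
  rw [hM, hJ', ← hc]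
  exact (sq_sum_le_card_mul_sum_sq (s := S) (f := d)).trans
    (Nat.mul_le_mul_left _ (Finset.sum_le_sum_of_subset (Finset.subset_univ S)))
end

section
/- Let d be a graphical degree sequence of length n satisfying, as an inequality over the real numbers, M(d) > 2·√(Δ(d)·(M(d) + M₂(d))) + 18·Δ(d) + 56. Then d is (8,8)-stable; that is, |Ω(d')| ≤ M(d)^8 · |Ω(d)| for every graphical degree sequence d' of length n with ‖d' − d‖₁ ≤ 8. -/
open Finset

namespace Stab
open Classical

noncomputable def dz {n : ℕ} (G : SimpleGraph (Fin n)) (a : Fin n) : ℤ :=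
  ∑ b, if G.Adj a b then (1:ℤ) else 0

noncomputable def Oz {n : ℕ} (f : Fin n → ℤ) : Finset (SimpleGraph (Fin n)) :=
  Finset.univ.filter (fun G => ∀ a, dz G a = f a)

noncomputable def N {n : ℕ} (f : Fin n → ℤ) : ℤ := ((Oz f).card : ℤ)

noncomputable def e {n : ℕ} (i : Fin n) : Fin n → ℤ := fun a => if a = i then 1 else 0

lemma N_nonneg {n : ℕ} (f : Fin n → ℤ) : 0 ≤ N f := by unfold N; positivity

lemma mem_Oz {n : ℕ} (f : Fin n → ℤ) (G : SimpleGraph (Fin n)) :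
    G ∈ Oz f ↔ ∀ a, dz G a = f a := by simp [Oz]

lemma sum_edge {n : ℕ} (p q a : Fin n) (h : p ≠ q) :
    (∑ b, if s(a,b) = s(p,q) then (1:ℤ) else 0) = e p a + e q a := by
  have : ∀ b, (if s(a,b) = s(p,q) then (1:ℤ) else 0)
      = (if b = q then e p a else 0) + (if b = p then e q a else 0) := by
    intro b
    simp only [e, Sym2.eq_iff]
    split_ifs <;> grind
  rw [Finset.sum_congr rfl fun b _ => this b]
  simp [Finset.sum_add_distrib]

/-- deletion of an edge -/
lemma L1 {n : ℕ} (f : Fin n → ℤ) (i : Fin n) (hi : 1 ≤ f i) :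
    N f ≤ ∑ x, N (f - e i - e x) := by
  have h1 : Oz f ⊆ Finset.univ.biUnion (fun x => (Oz f).filter (fun G => G.Adj i x)) := by
    intro G hG
    have h2 := (mem_Oz f G).1 hG i
    have : ∃ x, G.Adj i x := by
      by_contra hc
      push Not at hc
      simp [dz, hc] at h2
      omega
    obtain ⟨x, hx⟩ := this
    simp only [Finset.mem_biUnion, Finset.mem_filter]
    exact ⟨x, Finset.mem_univ _, hG, hx⟩
  have h3 : ∀ x, ((Oz f).filter (fun G => G.Adj i x)).card ≤ (Oz (f - e i - e x)).card := by
    intro x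
    apply Finset.card_le_card_of_injOn (fun G => G.deleteEdges {s(i,x)})
    · intro G hG
      simp only [Finset.coe_filter, Set.mem_setOf_eq, mem_Oz] at hG
      obtain ⟨hG, hx⟩ := hG
      simp only [Finset.mem_coe, mem_Oz]
      intro a
      have : dz (G.deleteEdges {s(i,x)}) a
          = dz G a - ∑ b, if s(a,b) = s(i,x) then (1:ℤ) else 0 := by
        unfold dz
        rw [← Finset.sum_sub_distrib]
        refine Finset.sum_congr rfl fun b _ => ?_
        by_cases hb : s(a,b) = s(i,x)
        · have : G.Adj a b := by
            rw [← SimpleGraph.mem_edgeSet, hb]; exact hx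
          simp [hb, this]
        · simp [hb]
      rw [this, sum_edge i x a hx.ne, hG a]
      simp only [Pi.sub_apply]; ring
    · intro G hG G' hG' hE
      simp only [Finset.coe_filter, Set.mem_setOf_eq] at hG hG'
      ext a b
      have := congrArg (fun H : SimpleGraph (Fin n) => H.Adj a b) hE
      simp only [SimpleGraph.deleteEdges_adj, Set.mem_singleton_iff, eq_iff_iff] at this
      by_cases hb : s(a,b) = s(i,x)
      · rw [← SimpleGraph.mem_edgeSet, ← SimpleGraph.mem_edgeSet, hb]
        simp [hG.2, hG'.2]
      · simpa [hb] using this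
  have h4 := (Finset.card_le_card h1).trans Finset.card_biUnion_le
  have h5 := h4.trans (Finset.sum_le_sum fun x _ => h3 x)
  unfold N
  exact_mod_cast h5

/-- good pairs -/
def good {n : ℕ} (G : SimpleGraph (Fin n)) (u v : Fin n) (p : Fin n × Fin n) : Prop :=
  G.Adj p.1 p.2 ∧ p.1 ≠ u ∧ ¬ G.Adj u p.1 ∧ p.2 ≠ v ∧ ¬ G.Adj v p.2

def sw {n : ℕ} (G : SimpleGraph (Fin n)) (u v z w : Fin n) : SimpleGraph (Fin n) :=
  SimpleGraph.fromEdgeSet ((G.edgeSet \ {s(z,w)}) ∪ {s(u,z), s(v,w)})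

lemma sw_adj {n : ℕ} (G : SimpleGraph (Fin n)) (u v z w a b : Fin n) (hz : z ≠ u) (hw : w ≠ v) :
    (sw G u v z w).Adj a b ↔
      (G.Adj a b ∧ s(a,b) ≠ s(z,w)) ∨ s(a,b) = s(u,z) ∨ s(a,b) = s(v,w) := by
  unfold sw
  rw [SimpleGraph.fromEdgeSet_adj]
  simp only [Set.mem_union, Set.mem_diff, SimpleGraph.mem_edgeSet, Set.mem_singleton_iff,
    Set.mem_insert_iff]
  constructor
  · rintro ⟨h, _⟩; exact h
  · intro h
    refine ⟨h, ?_⟩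
    rcases h with h | h | h
    · exact h.1.ne
    · rw [Sym2.eq_iff] at h; grind
    · rw [Sym2.eq_iff] at h; grind

lemma not_adj_of {n : ℕ} {G : SimpleGraph (Fin n)} {a b p q : Fin n} (h : s(a,b) = s(p,q)) :
    G.Adj a b ↔ G.Adj p q := by
  rw [← SimpleGraph.mem_edgeSet, ← SimpleGraph.mem_edgeSet, h]

lemma sw_deg {n : ℕ} (G : SimpleGraph (Fin n)) (u v z w a : Fin n) (h : good G u v (z,w)) :
    dz (sw G u v z w) a = dz G a + e u a + e v a := by
  obtain ⟨h1, h2, h3, h4, h5⟩ := h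
  simp only at h1 h2 h3 h4 h5
  have : dz (sw G u v z w) a
      = dz G a - (∑ b, if s(a,b) = s(z,w) then (1:ℤ) else 0)
        + (∑ b, if s(a,b) = s(u,z) then (1:ℤ) else 0)
        + (∑ b, if s(a,b) = s(v,w) then (1:ℤ) else 0) := by
    unfold dz
    rw [← Finset.sum_sub_distrib, ← Finset.sum_add_distrib, ← Finset.sum_add_distrib]
    refine Finset.sum_congr rfl fun b _ => ?_
    have hne : s(u,z) ≠ s(v,w) := by
      intro hh
      rw [Sym2.eq_iff] at hh
      rcases hh with ⟨rfl, rfl⟩ | ⟨rfl, rfl⟩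
      · exact h1.ne rfl
      · exact h3 h1.symm
    have hne1 : s(u,z) ≠ s(z,w) := fun hh => h3 ((not_adj_of hh).2 h1)
    have hne2 : s(v,w) ≠ s(z,w) := fun hh => h5 ((not_adj_of hh).2 h1)
    simp only [sw_adj G u v z w a b h2 h4]
    by_cases c1 : s(a,b) = s(z,w)
    · have := (not_adj_of c1 (G := G)).2 h1
      simp [c1, this, hne1.symm, hne2.symm]
    · by_cases c2 : s(a,b) = s(u,z)
      · have := (not_adj_of c2 (G := G)).not.2 h3
        simp [c2, this, hne1, hne]
      · by_cases c3 : s(a,b) = s(v,w)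
        · have := (not_adj_of c3 (G := G)).not.2 h5
          simp [c3, this, hne2, hne.symm]
        · simp [c1, c2, c3]
  rw [this, sum_edge z w a h1.ne, sum_edge u z a h2.symm, sum_edge v w a h4.symm]
  ring

lemma sw_inj {n : ℕ} (G G' : SimpleGraph (Fin n)) (u v z w : Fin n) (h : good G u v (z,w))
    (h' : good G' u v (z,w)) (hE : sw G u v z w = sw G' u v z w) : G = G' := by
  obtain ⟨h1, h2, h3, h4, h5⟩ := h
  obtain ⟨h1', h2', h3', h4', h5'⟩ := h'
  simp only at h1 h2 h3 h4 h5 h1' h3' h5'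
  ext a b
  have := congrArg (fun H : SimpleGraph (Fin n) => H.Adj a b) hE
  simp only [sw_adj _ u v z w a b h2 h4, eq_iff_iff] at this
  by_cases c1 : s(a,b) = s(z,w)
  · rw [not_adj_of c1, not_adj_of c1]; simp [h1, h1']
  · by_cases c2 : s(a,b) = s(u,z)
    · rw [not_adj_of c2, not_adj_of c2]; simp [h3, h3']
    · by_cases c3 : s(a,b) = s(v,w)
      · rw [not_adj_of c3, not_adj_of c3]; simp [h5, h5']
      · simpa [c1, c2, c3] using this

lemma card_nbr {n : ℕ} (G : SimpleGraph (Fin n)) (u : Fin n) :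
    (((Finset.univ.filter (fun z => G.Adj u z)).card : ℕ) : ℤ) = dz G u := by
  simp [dz]

lemma L2core {n : ℕ} (f : Fin n → ℤ) (u v : Fin n) (K : ℕ)
    (hK : ∀ G ∈ Oz f, K ≤ (Finset.univ.filter (good G u v)).card) :
    (K:ℤ) * N f ≤ (f + e u + e v) u * (f + e u + e v) v * N (f + e u + e v) := by
  set g := f + e u + e v with hg
  have h1 : ((Oz f).sigma (fun G => Finset.univ.filter (good G u v))).card ≤
      ((Oz g).sigma (fun H => (Finset.univ.filter (fun z => H.Adj u z)) ×ˢ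
        (Finset.univ.filter (fun z => H.Adj v z)))).card := by
    apply Finset.card_le_card_of_injOn (fun p => ⟨sw p.1 u v p.2.1 p.2.2, p.2⟩)
    · rintro ⟨G, z, w⟩ hp
      simp only [Finset.coe_sigma, Set.mem_sigma_iff, Finset.mem_coe, Finset.mem_filter,
        Finset.mem_univ, true_and, Finset.mem_sigma, Finset.mem_product, mem_Oz] at hp ⊢
      obtain ⟨hp, hq⟩ := hp
      refine ⟨?_, ?_, ?_⟩
      · intro a
        rw [sw_deg G u v z w a hq, hp a]; simp [hg]
      · rw [sw_adj _ _ _ _ _ _ _ hq.2.1 hq.2.2.2.1]; simp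
      · rw [sw_adj _ _ _ _ _ _ _ hq.2.1 hq.2.2.2.1]; simp
    · rintro ⟨G, z, w⟩ hp ⟨G', z', w'⟩ hp' hE
      simp only [Finset.coe_sigma, Set.mem_sigma_iff, Finset.mem_coe, Finset.mem_filter,
        Finset.mem_univ, true_and] at hp hp'
      simp only [Sigma.mk.injEq, heq_eq_eq, Prod.mk.injEq] at hE
      obtain ⟨hE, rfl, rfl⟩ := hE
      rw [sw_inj G G' u v z w hp.2 hp'.2 hE]
  rw [Finset.card_sigma, Finset.card_sigma] at h1
  have h2 : (K:ℤ) * N f ≤ ((∑ G ∈ Oz f, (Finset.univ.filter (good G u v)).card : ℕ) : ℤ) := by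
    have := Finset.card_nsmul_le_sum (Oz f) (fun G => (Finset.univ.filter (good G u v)).card) K hK
    simp only [smul_eq_mul] at this
    unfold N
    rw [mul_comm]
    exact_mod_cast this
  refine h2.trans ((Int.ofNat_le.2 h1).trans (le_of_eq ?_))
  push_cast
  rw [Finset.sum_congr rfl (g := fun _ => g u * g v)]
  · simp [N]; ring
  · intro H hH
    rw [mem_Oz] at hH
    rw [Finset.card_product]
    push_cast
    rw [card_nbr, card_nbr, hH, hH]

lemma count_good {n : ℕ} (G : SimpleGraph (Fin n)) (u v : Fin n) :
    (∑ z, dz G z) ≤ ((Finset.univ.filter (good G u v)).card : ℤ)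
      + (∑ z ∈ Finset.univ.filter (fun z => z = u ∨ G.Adj u z), dz G z)
      + (∑ z ∈ Finset.univ.filter (fun z => z = v ∨ G.Adj v z), dz G z) := by
  have e1 : ((Finset.univ.filter (good G u v)).card : ℤ)
      = ∑ z, ∑ w, if good G u v (z,w) then (1:ℤ) else 0 := by
    rw [← Fintype.sum_prod_type' (f := fun z w => if good G u v (z,w) then (1:ℤ) else 0)]
    simp
  have e2 : (∑ z ∈ Finset.univ.filter (fun z => z = u ∨ G.Adj u z), dz G z)
      = ∑ z, ∑ w, if (z = u ∨ G.Adj u z) ∧ G.Adj z w then (1:ℤ) else 0 := by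
    rw [Finset.sum_filter]
    refine Finset.sum_congr rfl fun z _ => ?_
    by_cases c : z = u ∨ G.Adj u z <;> simp [c, dz]
  have e3 : (∑ z ∈ Finset.univ.filter (fun z => z = v ∨ G.Adj v z), dz G z)
      = ∑ z, ∑ w, if (w = v ∨ G.Adj v w) ∧ G.Adj z w then (1:ℤ) else 0 := by
    rw [Finset.sum_filter, Finset.sum_comm]
    refine Finset.sum_congr rfl fun z _ => ?_
    by_cases c : z = v ∨ G.Adj v z <;> simp [c, dz, G.adj_comm]
  rw [e1, e2, e3, ← Finset.sum_add_distrib, ← Finset.sum_add_distrib]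
  unfold dz
  refine Finset.sum_le_sum fun z _ => ?_
  rw [← Finset.sum_add_distrib, ← Finset.sum_add_distrib]
  refine Finset.sum_le_sum fun w _ => ?_
  unfold good
  simp only
  split_ifs <;> first | omega | (exfalso; tauto)

def dist {n : ℕ} (f d : Fin n → ℤ) : ℤ := ∑ i, |f i - d i|

lemma dist_sum {n : ℕ} (f d : Fin n → ℤ) (S : Finset (Fin n)) :
    |∑ i ∈ S, f i - ∑ i ∈ S, d i| ≤ dist f d := by
  rw [← Finset.sum_sub_distrib]
  refine (Finset.abs_sum_le_sum_abs _ _).trans ?_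
  exact Finset.sum_le_sum_of_subset_of_nonneg (Finset.subset_univ _) (fun _ _ _ => abs_nonneg _)

lemma L2 {n : ℕ} (d : Fin n → ℤ) (D : ℤ) (hD : ∀ i, d i ≤ D)
    (hS : ∀ S : Finset (Fin n), (S.card : ℤ) ≤ D + 9 → 2 * ∑ i ∈ S, d i + 56 < ∑ i, d i)
    (g f : Fin n → ℤ) (u v : Fin n) (hgf : f = g - e u - e v) (hf : dist f d ≤ 8) :
    32 * N f ≤ g u * g v * N g := by
  have hg : g = f + e u + e v := by rw [hgf]; abel
  rw [hg]
  refine L2core f u v 32 ?_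
  intro G hG
  rw [mem_Oz] at hG
  have key : ∀ u, 2 * (∑ z ∈ Finset.univ.filter (fun z => z = u ∨ G.Adj u z), dz G z) + 40
      < ∑ i, d i := by
    intro u
    have hc : ((Finset.univ.filter (fun z => z = u ∨ G.Adj u z)).card : ℤ) ≤ D + 9 := by
      have h0 : (Finset.univ.filter (fun z => z = u ∨ G.Adj u z)).card
          ≤ (Finset.univ.filter (fun z => z = u)).card
            + (Finset.univ.filter (fun z => G.Adj u z)).card := by
        rw [Finset.filter_or]
        exact Finset.card_union_le _ _
      have h2 : (Finset.univ.filter (fun z => z = u)).card = 1 := by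
        simp [Finset.filter_eq']
      have h3 := card_nbr G u
      have h4 := dist_sum f d {u}
      simp only [Finset.sum_singleton] at h4
      rw [abs_le] at h4
      have := hD u
      have := hG u
      omega
    have h1 := hS _ hc
    have h2 := dist_sum f d (Finset.univ.filter (fun z => z = u ∨ G.Adj u z))
    rw [abs_le] at h2
    simp only [hG]
    omega
  have h1 := count_good G u v
  have h2 := key u
  have h3 := key v
  have h4 := dist_sum f d Finset.univ
  rw [abs_le] at h4
  have h5 : ∑ z, dz G z = ∑ z, f z := Finset.sum_congr rfl fun z _ => hG z
  omega

lemma even_sum {n : ℕ} (G : SimpleGraph (Fin n)) : Even (∑ z, dz G z) := by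
  have h : ∑ z, dz G z = ((∑ z, G.degree z : ℕ) : ℤ) := by
    push_cast
    refine Finset.sum_congr rfl fun z _ => ?_
    rw [← card_nbr, ← SimpleGraph.card_neighborFinset_eq_degree]
    congr 2
    ext; simp
  rw [h, SimpleGraph.sum_degrees_eq_twice_card_edges]
  simp

lemma dist_add {n : ℕ} (f d : Fin n → ℤ) (i : Fin n) (t : ℤ) :
    dist (f + t • e i) d = dist f d + |f i + t - d i| - |f i - d i| := by
  have : ∀ a, |(f + t • e i) a - d a|
      = |f a - d a| + (if a = i then |f i + t - d i| - |f i - d i| else 0) := by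
    intro a
    by_cases h : a = i
    · subst h; simp [e]
    · simp [e, h]
  unfold dist
  simp only [this, Finset.sum_add_distrib, Finset.sum_ite_eq', Finset.mem_univ, if_true]
  ring

lemma dist_sub_le {n : ℕ} (f d : Fin n → ℤ) (i : Fin n) :
    dist (f - e i) d ≤ dist f d + 1 := by
  have := dist_add f d i (-1)
  rw [show f - e i = f + (-1:ℤ) • e i by simp [sub_eq_add_neg]]
  rw [this]
  have : |f i + -1 - d i| ≤ |f i - d i| + 1 := by
    rcases abs_cases (f i + -1 - d i) with h | h <;> rcases abs_cases (f i - d i) with h' | h' <;> omega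
  omega

/-- one step towards d -/
lemma exists_step {n : ℕ} (f d : Fin n → ℤ) (h : f ≠ d) :
    ∃ i, (d i < f i ∧ dist (f - e i) d = dist f d - 1) ∨
      (f i < d i ∧ dist (f + e i) d = dist f d - 1) := by
  obtain ⟨i, hi⟩ := Function.ne_iff.1 h
  refine ⟨i, ?_⟩
  rcases lt_or_gt_of_ne hi with h | h
  · right
    refine ⟨h, ?_⟩
    have := dist_add f d i 1
    rw [one_smul] at this
    rw [this, abs_of_nonpos (by omega), abs_of_nonpos (by omega)]; ring
  · left
    refine ⟨h, ?_⟩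
    have := dist_add f d i (-1)
    rw [show f - e i = f + (-1:ℤ) • e i by simp [sub_eq_add_neg]]
    rw [this, abs_of_nonneg (by omega), abs_of_nonneg (by omega)]; ring

lemma sum_e {n : ℕ} (i : Fin n) : ∑ a, e i a = 1 := by simp [e]

/-- two steps with cost -/
lemma step {n : ℕ} (d : Fin n → ℤ) (D : ℤ) (hd0 : ∀ i, 0 ≤ d i) (hD : ∀ i, d i ≤ D)
    (hS : ∀ S : Finset (Fin n), (S.card : ℤ) ≤ D + 9 → 2 * ∑ i ∈ S, d i + 56 < ∑ i, d i)
    (hM : 56 ≤ ∑ i, d i)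
    (f : Fin n → ℤ) (hf : dist f d ≤ 8) (hne : f ≠ d) (hev : Even (∑ i, f i - ∑ i, d i)) :
    ∃ g, dist g d = dist f d - 2 ∧ N f ≤ (∑ i, d i)^2 * N g := by
  obtain ⟨i, hi⟩ := exists_step f d hne
  set M := ∑ i, d i with hMdef
  have fin : ∀ g : Fin n → ℤ, dist g d ≤ 8 → ∀ j, g j ≤ M + 8 := by
    intro g hg j
    have h1 := dist_sum g d {j}
    simp only [Finset.sum_singleton, abs_le] at h1
    have : d j ≤ M := Finset.single_le_sum (f := d) (fun i _ => hd0 i) (Finset.mem_univ j)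
    omega
  have finM : ∀ g : Fin n → ℤ, dist g d ≤ 8 → (∑ j, g j) ≤ M + 8 ∧ 0 ≤ ∑ j, g j := by
    intro g hg
    have h1 := dist_sum g d Finset.univ
    simp only [abs_le] at h1
    omega
  have fin0 : ∀ (g : Fin n → ℤ) j, N g = 0 ∨ 0 ≤ g j := by
    intro g j
    by_cases h : Oz g = ∅
    · left; simp [N, h]
    · right
      obtain ⟨G, hG⟩ := Finset.nonempty_iff_ne_empty.2 h
      rw [mem_Oz] at hG
      rw [← hG j, ← card_nbr]; positivity
  have wrap : ∀ (g : Fin n → ℤ) (A B : ℤ), A ≤ M + 8 → B ≤ M + 8 → (N g = 0 ∨ 0 ≤ A) →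
      (N g = 0 ∨ 0 ≤ B) → 32 * N f ≤ A * B * N g + 32 * N g → N f ≤ M^2 * N g := by
    intro g A B hA hB hA0 hB0 h
    have hN := N_nonneg g
    by_cases h0 : N g = 0
    · rw [h0] at h ⊢; linarith
    have hA0 := hA0.resolve_left h0
    have hB0 := hB0.resolve_left h0
    have h1 : A * B ≤ (M+8) * (M+8) := mul_le_mul hA hB hB0 (by omega)
    have h2 : A * B + 32 ≤ 32 * M^2 := by nlinarith
    have h3 : (A * B + 32) * N g ≤ 32 * M^2 * N g := mul_le_mul_of_nonneg_right h2 hN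
    linarith
  have trans : ∀ (g : Fin n → ℤ) (i j : Fin n), 1 ≤ f i → g = f - e i + e j → dist g d ≤ 6 →
      N f ≤ M^2 * N g := by
    intro g i j hi hg hgd
    have h1 := L1 f i hi
    have h2 : ∀ x, 32 * N (f - e i - e x) ≤ g x * g j * N g := by
      intro x
      refine L2 d D hD hS g _ x j (by rw [hg]; abel) ?_
      have h3 := dist_sub_le (g - e j) d x
      have h4 := dist_sub_le g d j
      rw [hg] at h3 h4
      simp only [add_sub_cancel_right] at h3 h4
      rw [← hg] at h4
      omega
    have h3 : 32 * N f ≤ (∑ x, g x) * g j * N g := by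
      rw [Finset.sum_mul, Finset.sum_mul]
      refine le_trans ?_ (Finset.sum_le_sum fun x _ => h2 x)
      rw [← Finset.mul_sum]; linarith
    refine wrap g _ _ (finM g (by omega)).1 (fin g (by omega) j) (Or.inr (finM g (by omega)).2)
      (fin0 g j) ?_
    have := N_nonneg g
    linarith
  have par : ∀ g : Fin n → ℤ, (∑ a, g a = ∑ a, f a + 1 ∨ ∑ a, g a = ∑ a, f a - 1) → g ≠ d := by
    rintro g hg rfl
    obtain ⟨r, hr⟩ := hev
    omega
  rcases hi with ⟨hi, hdi⟩ | ⟨hi, hdi⟩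
  · obtain ⟨j, hj⟩ := exists_step (f - e i) d (par _ (Or.inr (by simp [sum_e])))
    have := hd0 i
    rcases hj with ⟨hj, hdj⟩ | ⟨hj, hdj⟩
    · refine ⟨f - e i - e j, by omega, ?_⟩
      set g := f - e i - e j with hg
      have h1 := L1 f i (by omega)
      have h2 : ∀ x y, 32 * N (f - e i - e x - e j - e y) ≤ g x * g y * N g := by
        intro x y
        refine L2 d D hD hS g _ x y (by rw [hg]; abel) ?_
        have h3 := dist_sub_le (g - e x) d y
        have h4 := dist_sub_le g d x
        rw [show f - e i - e x - e j - e y = g - e x - e y by rw [hg]; abel]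
        omega
      have h2' : ∀ x, 32 * ∑ y, N (f - e i - e x - e j - e y) ≤ g x * (∑ y, g y) * N g := by
        intro x
        rw [Finset.mul_sum, Finset.mul_sum, Finset.sum_mul]
        exact Finset.sum_le_sum fun y _ => h2 x y
      have h3 : ∀ x, 32 * N (f - e i - e x) ≤
          g x * (∑ y, g y) * N g + if x = j then 32 * N g else 0 := by
        intro x
        by_cases hx : x = j
        · subst hx
          rw [if_pos rfl, ← hg]
          have : 0 ≤ 32 * ∑ y, N (f - e i - e x - e x - e y) :=
            mul_nonneg (by norm_num) (Finset.sum_nonneg fun _ _ => N_nonneg _)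
          linarith [h2' x]
        · rw [if_neg hx, add_zero]
          refine le_trans ?_ (h2' x)
          have := L1 (f - e i - e x) j (by
            have := hd0 j
            have h0 : e x j = 0 := by simp [e, Ne.symm hx]
            rw [Pi.sub_apply, h0]; omega)
          linarith
      have h4 : 32 * N f ≤ (∑ x, g x) * (∑ y, g y) * N g + 32 * N g := by
        have h5 := Finset.sum_le_sum fun x (_ : x ∈ Finset.univ) => h3 x
        rw [← Finset.mul_sum, Finset.sum_add_distrib, ← Finset.sum_mul, ← Finset.sum_mul] at h5
        simp only [Finset.sum_ite_eq', Finset.mem_univ, if_true] at h5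
        linarith
      have h5 := finM g (by omega)
      exact wrap g _ _ h5.1 h5.1 (Or.inr h5.2) (Or.inr h5.2) h4
    · exact ⟨f - e i + e j, by omega, trans _ i j (by omega) rfl (by omega)⟩
  · obtain ⟨j, hj⟩ := exists_step (f + e i) d (par _ (Or.inl (by simp [sum_e, Finset.sum_add_distrib])))
    rcases hj with ⟨hj, hdj⟩ | ⟨hj, hdj⟩
    · refine ⟨f + e i - e j, by omega, trans _ j i ?_ (by abel) (by omega)⟩
      have := hd0 j
      by_cases hij : j = i
      · subst hij
        simp [e] at hj
        omega
      · simp [e, hij] at hj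
        omega
    · refine ⟨f + e i + e j, by omega, ?_⟩
      have h1 := L2 d D hD hS (f + e i + e j) f i j (by abel) hf
      refine wrap _ _ _ (fin _ (by omega) i) (fin _ (by omega) j) (fin0 _ i) (fin0 _ j) ?_
      have := N_nonneg (f + e i + e j)
      linarith

lemma main {n : ℕ} (d : Fin n → ℤ) (D : ℤ) (hd0 : ∀ i, 0 ≤ d i) (hD : ∀ i, d i ≤ D)
    (hS : ∀ S : Finset (Fin n), (S.card : ℤ) ≤ D + 9 → 2 * ∑ i ∈ S, d i + 56 < ∑ i, d i)
    (hM : 56 ≤ ∑ i, d i) (hde : Even (∑ i, d i)) (k : ℕ) (hk : k ≤ 4) :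
    ∀ f : Fin n → ℤ, dist f d ≤ 2 * k → N f ≤ (∑ i, d i)^(2*k) * N d := by
  induction k with
  | zero =>
    intro f hf
    by_cases h : f = d
    · simp [h]
    · exfalso
      obtain ⟨i, hi⟩ := Function.ne_iff.1 h
      have h1 := dist_sum f d {i}
      simp only [Finset.sum_singleton, abs_le] at h1
      simp at hf
      omega
  | succ k ih =>
    intro f hf
    have hpow : (0:ℤ) ≤ (∑ i, d i)^2 := by positivity
    by_cases h : f = d
    · subst h
      exact le_mul_of_one_le_left (N_nonneg _) (one_le_pow₀ (by omega))
    by_cases h0 : Oz f = ∅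
    · have : N f = 0 := by simp [N, h0]
      rw [this]
      exact mul_nonneg (pow_nonneg (by omega) _) (N_nonneg _)
    obtain ⟨G, hG⟩ := Finset.nonempty_iff_ne_empty.2 h0
    rw [mem_Oz] at hG
    have hfe : Even (∑ i, f i) := by
      rw [← Finset.sum_congr rfl fun z _ => hG z]; exact even_sum G
    obtain ⟨g, hg, hN⟩ := step d D hd0 hD hS hM f (by push_cast at hf; omega) h (hfe.sub hde)
    have := ih (by omega) g (by push_cast at hf; omega)
    calc N f ≤ (∑ i, d i)^2 * N g := hN
      _ ≤ (∑ i, d i)^2 * ((∑ i, d i)^(2*k) * N d) := mul_le_mul_of_nonneg_left this hpow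
      _ = _ := by ring

lemma degOf_eq {n : ℕ} (G : SimpleGraph (Fin n)) (i : Fin n) : (degOf G i : ℤ) = dz G i := by
  rw [← card_nbr]
  unfold degOf
  rw [← Set.ncard_coe_finset]
  congr 2
  ext; simp

lemma N_eq {n : ℕ} (d : Fin n → ℕ) : N (fun i => (d i : ℤ)) = ((Omega d).ncard : ℤ) := by
  unfold N
  rw [← Set.ncard_coe_finset]
  congr 2
  ext G
  simp only [Finset.mem_coe, mem_Oz, Omega, Set.mem_setOf_eq, ← degOf_eq, Nat.cast_inj]

lemma cs {n : ℕ} (d : Fin n → ℕ) (S : Finset (Fin n)) (hS : S.card ≤ Δdeg d + 9) :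
    ((∑ i ∈ S, d i : ℕ) : ℝ) ≤
      Real.sqrt ((Δdeg d : ℝ) * ((Mdeg d : ℝ) + (M2deg d : ℝ))) + 9 * Δdeg d := by
  have hle : ∀ i, d i ≤ Δdeg d := fun i => Finset.le_sup (Finset.mem_univ i)
  obtain ⟨T, hTS, hT⟩ : ∃ T ⊆ S, T.card = S.card - 9 :=
    Finset.exists_subset_card_eq (by omega)
  have h1 : ∑ i ∈ S, d i = ∑ i ∈ S \ T, d i + ∑ i ∈ T, d i := (Finset.sum_sdiff hTS).symm
  have h2 : ∑ i ∈ S \ T, d i ≤ 9 * Δdeg d := by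
    have := Finset.sum_le_card_nsmul (S \ T) d (Δdeg d) (fun i _ => hle i)
    refine this.trans ?_
    rw [smul_eq_mul]
    apply Nat.mul_le_mul_right
    rw [Finset.card_sdiff_of_subset hTS]; omega
  have hsq : Mdeg d + M2deg d = ∑ i, d i ^ 2 := by
    unfold Mdeg M2deg
    rw [← Finset.sum_add_distrib]
    refine Finset.sum_congr rfl fun i _ => ?_
    rcases Nat.eq_zero_or_pos (d i) with h | h
    · simp [h]
    · obtain ⟨m, hm⟩ := Nat.exists_eq_succ_of_ne_zero h.ne'
      rw [hm]; simp; ring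
  have h3 : (∑ i ∈ T, d i)^2 ≤ Δdeg d * (Mdeg d + M2deg d) := by
    rw [hsq]
    refine (sq_sum_le_card_mul_sum_sq (s := T) (f := d)).trans ?_
    apply Nat.mul_le_mul (by rw [Nat.cast_id]; omega)
    exact Finset.sum_le_sum_of_subset (Finset.subset_univ _)
  have h4 : ((∑ i ∈ T, d i : ℕ) : ℝ) ≤
      Real.sqrt ((Δdeg d : ℝ) * ((Mdeg d : ℝ) + (M2deg d : ℝ))) := by
    apply Real.le_sqrt_of_sq_le
    exact_mod_cast h3
  have h2' : ((∑ i ∈ S \ T, d i : ℕ) : ℝ) ≤ 9 * Δdeg d := by exact_mod_cast h2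
  rw [h1, Nat.cast_add]
  linarith

end Stab

/-- Theorem 5.1: if
`M(d) > 2√(Δ(d)(M(d)+M₂(d))) + 18Δ(d) + 56` then `d` is `(8,8)`-stable. -/
theorem stmt_8 {n : ℕ} (d : Fin n → ℕ) (hd : Graphical d)
    (h : (Mdeg d : ℝ) >
      2 * Real.sqrt ((Δdeg d : ℝ) * ((Mdeg d : ℝ) + (M2deg d : ℝ)))
        + 18 * (Δdeg d : ℝ) + 56) :
    Stable 8 8 d := by
  intro d' _ hdist
  have hle : ∀ i, d i ≤ Δdeg d := fun i => Finset.le_sup (Finset.mem_univ i)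
  have hMz : (∑ i, (d i : ℤ)) = (Mdeg d : ℤ) := by simp [Mdeg]
  have hS : ∀ S : Finset (Fin n), (S.card : ℤ) ≤ (Δdeg d : ℤ) + 9 →
      2 * ∑ i ∈ S, (d i : ℤ) + 56 < ∑ i, (d i : ℤ) := by
    intro S hc
    have h1 := Stab.cs d S (by exact_mod_cast hc)
    have h2 : 2 * ((∑ i ∈ S, d i : ℕ) : ℝ) + 56 < (Mdeg d : ℝ) := by linarith
    rw [hMz]
    exact_mod_cast h2
  have hM : 56 ≤ ∑ i, (d i : ℤ) := by
    have := hS ∅ (by simp; positivity)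
    simp only [Finset.sum_empty] at this
    omega
  have hev : Even (∑ i, (d i : ℤ)) := by
    obtain ⟨G, hG⟩ := hd
    rw [← Finset.sum_congr rfl fun z _ => (by rw [← Stab.degOf_eq, hG z] : Stab.dz G z = (d z : ℤ))]
    exact Stab.even_sum G
  have hk := Stab.main (fun i => (d i : ℤ)) (Δdeg d) (fun i => by positivity)
    (fun i => by exact_mod_cast hle i) hS hM hev 4 le_rfl (fun i => (d' i : ℤ)) (by
      have : Stab.dist (fun i => (d' i : ℤ)) (fun i => (d i : ℤ)) = (l1dist d' d : ℤ) := by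
        simp [Stab.dist, l1dist]
      rw [this]; push_cast; omega)
  rw [Stab.N_eq, Stab.N_eq, hMz] at hk
  have h8 : (Mdeg d : ℝ) ^ (8:ℝ) = (Mdeg d : ℝ) ^ (8:ℕ) := by
    rw [← Real.rpow_natCast]; norm_num
  rw [h8]
  norm_num at hk
  exact_mod_cast hk
end

section
/- Let d be a graphical degree sequence of length n all of whose entries take values in {δ, Δ} with δ ≤ Δ, and let ℓ be the number of indices i with d_i = Δ. Suppose that either (a) ℓ ≥ Δ and Δ·ℓ + (n − ℓ)·δ > 2Δ² + 18Δ + 56, or (b) ℓ < Δ and n·δ > (Δ − δ)·ℓ + 2δΔ + 18Δ + 56. Then d is (8,8)-stable; that is, |Ω(d')| ≤ M(d)^8 · |Ω(d)| for every graphical degree sequence d' of length n with ‖d' − d‖₁ ≤ 8. -/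
open Finset

namespace BR
open Classical

/-- indicator -/
def I {n : ℕ} (a w : Fin n) : ℕ := if w = a then 1 else 0

lemma sum_I {n : ℕ} (a : Fin n) : ∑ w, I a w = 1 := by simp [I]

lemma I_self {n : ℕ} (a : Fin n) : I a a = 1 := by simp [I]

lemma I_ne {n : ℕ} {a w : Fin n} (h : w ≠ a) : I a w = 0 := by simp [I, h]

lemma degOf_eq {n : ℕ} (G : SimpleGraph (Fin n)) (i : Fin n) :
    degOf G i = (univ.filter (fun v => G.Adj i v)).card := by
  unfold degOf
  rw [Set.ncard_eq_toFinset_card']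
  congr 1
  ext v; simp

lemma degOf_sum {n : ℕ} (G : SimpleGraph (Fin n)) (i : Fin n) :
    degOf G i = ∑ v, if G.Adj i v then 1 else 0 := by
  rw [degOf_eq, card_filter]

lemma even_sum {n : ℕ} {e : Fin n → ℕ} (G : SimpleGraph (Fin n)) (h : G ∈ Omega e) :
    Even (Mdeg e) := by
  have h1 := G.sum_degrees_eq_twice_card_edges
  have h2 : ∀ i, G.degree i = e i := by
    intro i
    rw [← h i, degOf_eq, ← SimpleGraph.card_neighborFinset_eq_degree]
    congr 1
    ext v; simp
  have : Mdeg e = ∑ i, G.degree i := by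
    unfold Mdeg; exact sum_congr rfl (fun i _ => (h2 i).symm)
  rw [this, h1]; exact even_two_mul _

lemma edge_adj' {n : ℕ} (a b x y : Fin n) :
    (SimpleGraph.edge a b).Adj x y ↔ ((x = a ∧ y = b) ∨ (x = b ∧ y = a)) ∧ x ≠ y := by
  rw [SimpleGraph.edge_adj]
  
lemma deg_add {n : ℕ} (G : SimpleGraph (Fin n)) {a b : Fin n} (hab : a ≠ b)
    (h : ¬ G.Adj a b) (w : Fin n) :
    degOf (G ⊔ SimpleGraph.edge a b) w = degOf G w + I a w + I b w := by
  have key : ∀ v, (if (G ⊔ SimpleGraph.edge a b).Adj w v then 1 else 0) =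
      (if G.Adj w v then 1 else 0) + I a w * I b v + I b w * I a v := by
    intro v
    have h' : ¬ G.Adj b a := fun hh => h hh.symm
    simp only [SimpleGraph.sup_adj, edge_adj', I]
    by_cases h1 : w = a <;> by_cases h2 : w = b <;> by_cases h3 : v = a <;> by_cases h4 : v = b <;>
      subst_vars <;> simp_all
  have key2 : (∑ v, if (G ⊔ SimpleGraph.edge a b).Adj w v then 1 else 0) = _ :=
    sum_congr rfl (fun v _ => key v)
  have key3 := degOf_sum (G ⊔ SimpleGraph.edge a b) w
  have key4 : degOf (G ⊔ SimpleGraph.edge a b) w =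
      ∑ v, ((if G.Adj w v then 1 else 0) + I a w * I b v + I b w * I a v) := by
    refine Eq.trans ?_ key2
    rw [key3]
    congr!
  rw [key4, degOf_sum G, sum_add_distrib, sum_add_distrib,
    ← mul_sum, ← mul_sum, sum_I, sum_I]
  ring

lemma del_add {n : ℕ} (G : SimpleGraph (Fin n)) {a b : Fin n} (h : G.Adj a b) :
    (G \ SimpleGraph.edge a b) ⊔ SimpleGraph.edge a b = G := by
  apply sdiff_sup_cancel
  intro x y hxy
  rw [edge_adj'] at hxy
  obtain ⟨⟨rfl, rfl⟩ | ⟨rfl, rfl⟩, _⟩ := hxy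
  · exact h
  · exact h.symm

lemma deg_del {n : ℕ} (G : SimpleGraph (Fin n)) {a b : Fin n} (h : G.Adj a b) (w : Fin n) :
    degOf (G \ SimpleGraph.edge a b) w + I a w + I b w = degOf G w := by
  conv_rhs => rw [← del_add G h]
  rw [deg_add _ h.ne]
  simp [edge_adj', h.ne]

/-- ordered edges -/
noncomputable def darts {n : ℕ} (G : SimpleGraph (Fin n)) : Finset (Fin n × Fin n) :=
  univ.filter (fun t => G.Adj t.1 t.2)

lemma card_darts_in {n : ℕ} (G : SimpleGraph (Fin n)) (S : Finset (Fin n)) :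
    ((darts G).filter (fun t => t.1 ∈ S)).card = ∑ u ∈ S, degOf G u := by
  rw [card_eq_sum_card_fiberwise (f := Prod.fst) (t := S)]
  · refine sum_congr rfl fun u hu => ?_
    rw [degOf_eq]
    refine (card_bij (fun v _ => (u, v)) ?_ ?_ ?_).symm
    · intro v hv; simp [darts] at hv ⊢; exact ⟨hv, hu⟩
    · intro a _ b _ hab; simpa using hab
    · rintro ⟨a, b⟩ hab
      simp [darts] at hab ⊢
      obtain ⟨⟨h1, h2⟩, rfl⟩ := hab
      exact ⟨rfl, h1⟩
  · intro t ht
    simp at ht; exact ht.2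

lemma card_darts_in' {n : ℕ} (G : SimpleGraph (Fin n)) (S : Finset (Fin n)) :
    ((darts G).filter (fun t => t.2 ∈ S)).card = ∑ u ∈ S, degOf G u := by
  rw [← card_darts_in]
  refine card_bij (fun t _ => (t.2, t.1)) ?_ ?_ ?_
  · rintro ⟨a, b⟩ h; simp [darts] at h ⊢; exact ⟨h.1.symm, h.2⟩
  · rintro ⟨a, b⟩ _ ⟨c, d⟩ _ h; simp at h ⊢; tauto
  · rintro ⟨a, b⟩ h; refine ⟨(b, a), ?_, rfl⟩; simp [darts] at h ⊢; exact ⟨h.1.symm, h.2⟩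

lemma card_darts {n : ℕ} (G : SimpleGraph (Fin n)) : (darts G).card = ∑ u, degOf G u := by
  rw [← card_darts_in]; simp

/-- closed neighbourhood -/
noncomputable def N {n : ℕ} (G : SimpleGraph (Fin n)) (p : Fin n) : Finset (Fin n) :=
  insert p (univ.filter (fun v => G.Adj p v))

lemma card_N {n : ℕ} (G : SimpleGraph (Fin n)) (p : Fin n) : (N G p).card ≤ degOf G p + 1 := by
  rw [degOf_eq]; exact card_insert_le _ _

noncomputable def good {n : ℕ} (G : SimpleGraph (Fin n)) (p q : Fin n) : Finset (Fin n × Fin n) :=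
  (darts G).filter (fun t => t.1 ∉ N G p ∧ t.2 ∉ N G q)

lemma card_good {n : ℕ} (G : SimpleGraph (Fin n)) (p q : Fin n) :
    ∑ u, degOf G u ≤ (good G p q).card + ∑ u ∈ N G p, degOf G u + ∑ u ∈ N G q, degOf G u := by
  rw [← card_darts, ← card_darts_in, ← card_darts_in']
  refine (card_le_card (t := good G p q ∪ (darts G).filter (fun t => t.1 ∈ N G p) ∪
    (darts G).filter (fun t => t.2 ∈ N G q)) ?_).trans ?_
  · intro t ht
    simp only [good, mem_union, mem_filter]
    tauto
  · exact (card_union_le _ _).trans (Nat.add_le_add_right (card_union_le _ _) _)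

noncomputable def OmF {n : ℕ} (e : Fin n → ℕ) : Finset (SimpleGraph (Fin n)) :=
  univ.filter (fun G => G ∈ Omega e)

lemma card_OmF {n : ℕ} (e : Fin n → ℕ) : (Omega e).ncard = (OmF e).card := by
  rw [← Set.ncard_coe_finset]; congr 1; ext G; simp [OmF]

noncomputable def X {n : ℕ} (e : Fin n → ℕ) : Finset (Fin n × Fin n × SimpleGraph (Fin n)) :=
  univ.filter (fun t => ∀ w, degOf t.2.2 w + I t.1 w + I t.2.1 w = e w)

def sw {n : ℕ} (G : SimpleGraph (Fin n)) (p q u v : Fin n) : SimpleGraph (Fin n) :=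
  (G \ SimpleGraph.edge u v) ⊔ SimpleGraph.edge p u ⊔ SimpleGraph.edge q v

lemma mem_good {n : ℕ} {G : SimpleGraph (Fin n)} {p q u v : Fin n} (h : (u, v) ∈ good G p q) :
    G.Adj u v ∧ p ≠ u ∧ q ≠ v ∧ ¬ G.Adj p u ∧ ¬ G.Adj q v := by
  simp [good, darts, N] at h
  obtain ⟨h1, ⟨h2, h3⟩, h4, h5⟩ := h
  exact ⟨h1, Ne.symm h2, Ne.symm h4, h3, h5⟩

lemma sw_facts {n : ℕ} {G : SimpleGraph (Fin n)} {p q u v : Fin n} (h : (u, v) ∈ good G p q) :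
    (∀ w, degOf (sw G p q u v) w = degOf G w + I p w + I q w) ∧
    (sw G p q u v).Adj p u ∧ (sw G p q u v).Adj q v ∧
    ((sw G p q u v \ SimpleGraph.edge p u) \ SimpleGraph.edge q v) ⊔ SimpleGraph.edge u v = G := by
  obtain ⟨h1, h2, h3, h4, h5⟩ := mem_good h
  refine ⟨?_, ?_, ?_, ?_⟩
  · intro w
    have a1 := deg_del G h1 w
    have a2 := deg_add (G \ SimpleGraph.edge u v) h2 (by simp [h4]) w
    have a3 := deg_add (G \ SimpleGraph.edge u v ⊔ SimpleGraph.edge p u) h3 (by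
      simp only [SimpleGraph.sup_adj, SimpleGraph.sdiff_adj, edge_adj', h5]
      rintro (h | ⟨⟨rfl, rfl⟩ | ⟨rfl, rfl⟩, _⟩)
      · exact h.1
      · exact h1.ne rfl
      · exact h4 h1.symm) w
    unfold sw
    omega
  · simp [sw, edge_adj', h2]
  · simp [sw, edge_adj', h3]
  · have h1' := h1.symm
    have h4' : ¬ G.Adj u p := fun hh => h4 hh.symm
    have h5' : ¬ G.Adj v q := fun hh => h5 hh.symm
    have b1 : SimpleGraph.edge u v ≤ G := by
      rw [← del_add G h1]; exact le_sup_right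
    have b2 : Disjoint G (SimpleGraph.edge p u) := by
      rw [disjoint_iff]; ext x y
      simp only [SimpleGraph.inf_adj, edge_adj', SimpleGraph.bot_adj, iff_false]
      rintro ⟨hx, ⟨rfl, rfl⟩ | ⟨rfl, rfl⟩, _⟩ <;> contradiction
    have b3 : Disjoint G (SimpleGraph.edge q v) := by
      rw [disjoint_iff]; ext x y
      simp only [SimpleGraph.inf_adj, edge_adj', SimpleGraph.bot_adj, iff_false]
      rintro ⟨hx, ⟨rfl, rfl⟩ | ⟨rfl, rfl⟩, _⟩ <;> contradiction
    have c1 := fun x y (h : (SimpleGraph.edge u v).Adj x y) => b1 h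
    have c2 : ∀ x y, G.Adj x y → ¬ (SimpleGraph.edge p u).Adj x y := by
      intro x y hx hy
      have : (G ⊓ SimpleGraph.edge p u).Adj x y := ⟨hx, hy⟩
      rw [disjoint_iff.1 b2] at this; exact this
    have c3 : ∀ x y, G.Adj x y → ¬ (SimpleGraph.edge q v).Adj x y := by
      intro x y hx hy
      have : (G ⊓ SimpleGraph.edge q v).Adj x y := ⟨hx, hy⟩
      rw [disjoint_iff.1 b3] at this; exact this
    ext x y
    have c1 := c1 x y
    have c2 := c2 x y
    have c3 := c3 x y
    simp only [sw, SimpleGraph.sup_adj, SimpleGraph.sdiff_adj]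
    tauto

lemma core {n : ℕ} (e : Fin n → ℕ) (m : ℕ)
    (hm : ∀ t ∈ X e, m ≤ (good t.2.2 t.1 t.2.1).card) :
    m * (X e).card ≤ (Mdeg e) ^ 2 * (OmF e).card := by
  have h1 : m * (X e).card ≤ ((X e).sigma (fun t => good t.2.2 t.1 t.2.1)).card := by
    rw [card_sigma, mul_comm, ← smul_eq_mul]
    exact card_nsmul_le_sum _ _ _ hm
  have h2 : ((OmF e).sigma (fun H => darts H ×ˢ darts H)).card = (Mdeg e) ^ 2 * (OmF e).card := by
    rw [card_sigma, sum_congr rfl (g := fun _ => (Mdeg e) ^ 2)]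
    · rw [sum_const, smul_eq_mul, mul_comm]
    · intro H hH
      rw [card_product, card_darts]
      have : ∑ u, degOf H u = Mdeg e := by
        simp only [OmF, mem_filter] at hH
        exact sum_congr rfl fun i _ => hH.2 i
      rw [this, sq]
  rw [← h2]
  refine h1.trans (card_le_card_of_injOn
    (fun s => ⟨sw s.1.2.2 s.1.1 s.1.2.1 s.2.1 s.2.2, ((s.1.1, s.2.1), (s.1.2.1, s.2.2))⟩) ?_ ?_)
  · rintro ⟨⟨p, q, G⟩, ⟨u, v⟩⟩ hs
    simp only [coe_sigma, Set.mem_sigma_iff, mem_coe, X, mem_filter, mem_univ, true_and] at hs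
    obtain ⟨f1, f2, f3, -⟩ := sw_facts hs.2
    simp only [coe_sigma, Set.mem_sigma_iff, mem_coe, OmF, mem_filter, mem_univ, true_and,
      mem_product, darts]
    refine ⟨?_, f2, f3⟩
    intro w
    rw [f1 w]; exact hs.1 w
  · rintro ⟨⟨p, q, G⟩, ⟨u, v⟩⟩ hs ⟨⟨p', q', G'⟩, ⟨u', v'⟩⟩ hs' heq
    simp only [coe_sigma, Set.mem_sigma_iff, mem_coe] at hs hs'
    obtain ⟨-, -, -, f4⟩ := sw_facts hs.2
    obtain ⟨-, -, -, f4'⟩ := sw_facts hs'.2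
    simp only [Sigma.mk.injEq, heq_eq_eq, Prod.mk.injEq] at heq
    obtain ⟨g1, ⟨rfl, rfl⟩, rfl, rfl⟩ := heq
    rw [g1] at f4
    have : G = G' := f4.symm.trans f4'
    subst this; rfl

/-- the abstract hypothesis -/
def Hyp {n : ℕ} (d : Fin n → ℕ) (Δ K : ℕ) : Prop :=
  (∀ i, d i ≤ Δ) ∧ (∀ S : Finset (Fin n), S.card ≤ Δ + 9 → ∑ u ∈ S, d u ≤ K) ∧
  2 * K + 57 ≤ Mdeg d

lemma le_dist {n : ℕ} (e d : Fin n → ℕ) (S : Finset (Fin n)) :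
    ∑ u ∈ S, e u ≤ ∑ u ∈ S, d u + l1dist e d := by
  unfold l1dist
  calc ∑ u ∈ S, e u ≤ ∑ u ∈ S, (d u + ((e u : ℤ) - (d u : ℤ)).natAbs) :=
        sum_le_sum fun u _ => by omega
    _ = ∑ u ∈ S, d u + ∑ u ∈ S, ((e u : ℤ) - (d u : ℤ)).natAbs := sum_add_distrib
    _ ≤ _ := Nat.add_le_add_left (sum_le_sum_of_subset (subset_univ _)) _

lemma dist_comm {n : ℕ} (e d : Fin n → ℕ) : l1dist e d = l1dist d e := by
  unfold l1dist; exact sum_congr rfl fun i _ => by omega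

lemma X_bound {n : ℕ} {d : Fin n → ℕ} {Δ K : ℕ} (H : Hyp d Δ K) (e : Fin n → ℕ)
    (he : l1dist e d ≤ 6) : 37 * (X e).card ≤ (Mdeg d + 6) ^ 2 * (OmF e).card := by
  obtain ⟨H1, H2, H3⟩ := H
  have hM1 : Mdeg e ≤ Mdeg d + 6 := (le_dist e d univ).trans (Nat.add_le_add_left he _)
  have hM2 : Mdeg d ≤ Mdeg e + 6 :=
    (le_dist d e univ).trans (Nat.add_le_add_left (by rw [dist_comm]; exact he) _)
  refine (core e 37 ?_).trans (Nat.mul_le_mul_right _ (Nat.pow_le_pow_left hM1 2))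
  rintro ⟨p, q, G⟩ ht
  simp only [X, mem_filter, mem_univ, true_and] at ht ⊢
  have hN : ∀ r, ∑ u ∈ N G r, degOf G u ≤ K + 6 := by
    intro r
    have h1 : degOf G r ≤ Δ + 6 := by
      have a := le_dist e d {r}
      simp only [sum_singleton] at a
      have := H1 r
      have := ht r
      omega
    have h2 := H2 (N G r) ((card_N G r).trans (by omega))
    have h3 := le_dist e d (N G r)
    have h4 : ∑ u ∈ N G r, degOf G u ≤ ∑ u ∈ N G r, e u :=
      sum_le_sum fun u _ => by have := ht u; omega
    omega
  have hs : ∑ u, degOf G u + 2 = Mdeg e := by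
    unfold Mdeg
    rw [← sum_congr rfl (fun w _ => ht w), sum_add_distrib, sum_add_distrib, sum_I, sum_I]
  have := card_good G p q
  have := hN p
  have := hN q
  omega

lemma exists_nbr {n : ℕ} (G : SimpleGraph (Fin n)) (i : Fin n) (h : 1 ≤ degOf G i) :
    ∃ x, G.Adj i x := by
  rw [degOf_eq] at h
  obtain ⟨x, hx⟩ := card_pos.1 h
  exact ⟨x, by simpa using hx⟩

lemma op3 {n : ℕ} (e e' : Fin n → ℕ) (i j : Fin n) (h : ∀ w, e' w = e w + I i w + I j w) :
    (OmF e).card ≤ (X e').card := by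
  refine card_le_card_of_injOn (fun G => (i, j, G)) ?_ ?_
  · intro G hG
    simp only [OmF, X, mem_coe, mem_filter, mem_univ, true_and] at hG ⊢
    intro w; rw [h w, hG w]
  · intro G _ G' _ hh; simpa using hh

lemma op1 {n : ℕ} (e e' : Fin n → ℕ) (i j : Fin n) (hi : 1 ≤ e i)
    (h : ∀ w, e' w + I i w = e w + I j w) :
    (OmF e).card ≤ (X e').card := by
  have : ∀ G : SimpleGraph (Fin n), ∃ x, G ∈ Omega e → G.Adj i x := by
    intro G
    by_cases hG : G ∈ Omega e
    · obtain ⟨x, hx⟩ := exists_nbr G i (by rw [hG i]; exact hi)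
      exact ⟨x, fun _ => hx⟩
    · exact ⟨i, fun h => absurd h hG⟩
  choose x hx using this
  refine card_le_card_of_injOn (fun G => (x G, j, G \ SimpleGraph.edge i (x G))) ?_ ?_
  · intro G hG
    simp only [OmF, X, mem_coe, mem_filter, mem_univ, true_and] at hG ⊢
    intro w
    have := deg_del G (hx G hG) w
    have := h w
    have := hG w
    omega
  · intro G hG G' hG' hh
    simp only [OmF, mem_coe, mem_filter, mem_univ, true_and] at hG hG'
    simp only [Prod.mk.injEq, true_and] at hh
    rw [← del_add G (hx G hG), ← del_add G' (hx G' hG'), hh.2, hh.1]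

lemma op2 {n : ℕ} (e e' : Fin n → ℕ) (i j : Fin n) (hi : 1 ≤ e i) (hj : 1 ≤ e j)
    (hij : i = j → 2 ≤ e i)
    (h : ∀ w, e' w + I i w + I j w = e w) :
    (OmF e).card ≤ (X e').card + (OmF e').card := by
  rw [← card_filter_add_card_filter_not (s := OmF e) (fun G => ¬ G.Adj i j)]
  refine Nat.add_le_add ?_ ?_
  · have : ∀ G : SimpleGraph (Fin n), ∃ x y, G ∈ Omega e ∧ ¬ G.Adj i j →
        G.Adj i x ∧ (G \ SimpleGraph.edge i x).Adj j y := by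
      intro G
      by_cases hG : G ∈ Omega e ∧ ¬ G.Adj i j
      · obtain ⟨x, hx⟩ := exists_nbr G i (by rw [hG.1 i]; exact hi)
        have hxj : x ≠ j := by rintro rfl; exact hG.2 hx
        obtain ⟨y, hy⟩ := exists_nbr (G \ SimpleGraph.edge i x) j (by
          have a := deg_del G hx j
          rw [hG.1 j, I_ne hxj.symm] at a
          by_cases hh : i = j
          · have := hij hh
            subst hh
            rw [I_self] at a; omega
          · rw [I_ne (Ne.symm hh)] at a; omega)
        exact ⟨x, y, fun _ => ⟨hx, hy⟩⟩
      · exact ⟨i, i, fun h => absurd h hG⟩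
    choose x y hxy using this
    refine card_le_card_of_injOn (fun G => (x G, y G,
      (G \ SimpleGraph.edge i (x G)) \ SimpleGraph.edge j (y G))) ?_ ?_
    · intro G hG
      simp only [OmF, X, mem_coe, mem_filter, mem_univ, true_and] at hG ⊢
      intro w
      have := deg_del G (hxy G hG).1 w
      have := deg_del _ (hxy G hG).2 w
      have := h w
      have := hG.1 w
      omega
    · intro G hG G' hG' hh
      simp only [OmF, mem_coe, mem_filter, mem_univ, true_and] at hG hG'
      simp only [Prod.mk.injEq] at hh
      rw [← del_add G (hxy G hG).1, ← del_add G' (hxy G' hG').1,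
        ← del_add _ (hxy G hG).2, ← del_add _ (hxy G' hG').2, hh.2.2, hh.2.1, hh.1]
  · refine card_le_card_of_injOn (fun G => G \ SimpleGraph.edge i j) ?_ ?_
    · intro G hG
      simp only [OmF, mem_coe, mem_filter, mem_univ, true_and, not_not] at hG ⊢
      intro w
      have := deg_del G hG.2 w
      have := h w
      have := hG.1 w
      omega
    · intro G hG G' hG' hh
      simp only [OmF, mem_coe, mem_filter, mem_univ, true_and, not_not] at hG hG'
      rw [← del_add G hG.2, ← del_add G' hG'.2]
      exact congrArg (· ⊔ SimpleGraph.edge i j) hh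

lemma dist_step {n : ℕ} (e e' d : Fin n → ℕ) (i j : Fin n)
    (h : ∀ w, ((e' w : ℤ) - (d w : ℤ)).natAbs + I i w + I j w = ((e w : ℤ) - (d w : ℤ)).natAbs) :
    l1dist e' d + 2 = l1dist e d := by
  unfold l1dist
  rw [← sum_congr rfl (fun w _ => h w), sum_add_distrib, sum_add_distrib, sum_I, sum_I]

lemma I_cases {n : ℕ} (a w : Fin n) : (w = a ∧ I a w = 1) ∨ (w ≠ a ∧ I a w = 0) := by
  by_cases h : w = a
  · left; exact ⟨h, by simp [I, h]⟩
  · right; exact ⟨h, I_ne h⟩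

/-- two units of surplus -/
lemma two_units {n : ℕ} (a b : Fin n → ℕ) (hab : ∀ i, b i ≤ a i) (hne : ∃ i, b i < a i)
    (ha : Even (∑ i, a i)) (hb : Even (∑ i, b i)) :
    ∃ i j, ∀ w, b w + I i w + I j w ≤ a w := by
  obtain ⟨i, hi⟩ := hne
  by_contra hcon
  push Not at hcon
  have : ∑ w, a w = ∑ w, b w + 1 := by
    rw [← sum_I i, ← sum_add_distrib]
    refine sum_congr rfl fun w _ => ?_
    rcases I_cases i w with ⟨rfl, h1⟩ | ⟨h0, h1⟩
    · by_contra hh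
      obtain ⟨z, hz⟩ := hcon w w
      rcases I_cases w z with ⟨rfl, h2⟩ | ⟨_, h2⟩
      · omega
      · have := hab z; omega
    · by_contra hh
      obtain ⟨z, hz⟩ := hcon i w
      have := hab z
      have := hab w
      rcases I_cases i z with ⟨rfl, h2⟩ | ⟨_, h2⟩ <;> rcases I_cases w z with ⟨h4, h3⟩ | ⟨_, h3⟩
      · exact h0 h4.symm
      · omega
      · subst h4; omega
      · omega
  rw [this] at ha
  exact (Nat.even_add_one.1 ha) hb

lemma step {n : ℕ} {d : Fin n → ℕ} {Δ K : ℕ} (H : Hyp d Δ K) (hd : Even (Mdeg d))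
    (e : Fin n → ℕ) (he : l1dist e d ≤ 8) (hev : Even (Mdeg e)) (hne : e ≠ d) :
    ∃ e', l1dist e' d + 2 = l1dist e d ∧ Even (Mdeg e') ∧
      (OmF e).card ≤ (Mdeg d) ^ 2 * (OmF e').card := by
  have hM : 57 ≤ Mdeg d := by have := H.2.2; omega
  have fin : ∀ e', l1dist e' d + 2 = l1dist e d → (OmF e).card ≤ (X e').card + (OmF e').card →
      (OmF e).card ≤ (Mdeg d) ^ 2 * (OmF e').card := by
    intro e' h1 h2
    have h3 := X_bound H e' (by omega)
    have h4 : (Mdeg d + 6) ^ 2 + 37 ≤ 37 * (Mdeg d) ^ 2 := by nlinarith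
    have h5 := Nat.mul_le_mul_right (OmF e').card h4
    nlinarith
  have evn : ∀ e' : Fin n → ℕ, ∀ i j : Fin n, (∀ w, e' w = e w + I i w + I j w) →
      Even (Mdeg e') := by
    intro e' i j h
    unfold Mdeg
    rw [sum_congr rfl (fun w _ => h w), sum_add_distrib, sum_add_distrib, sum_I, sum_I, add_assoc]
    exact hev.add even_two
  have evn2 : ∀ e' : Fin n → ℕ, ∀ i j : Fin n, (∀ w, e' w + I i w + I j w = e w) →
      Even (Mdeg e') := by
    intro e' i j h
    unfold Mdeg at hev ⊢
    rw [← sum_congr rfl (fun w _ => h w), sum_add_distrib, sum_add_distrib, sum_I, sum_I,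
      add_assoc] at hev
    exact (Nat.even_add.1 hev).2 even_two
  have evn1 : ∀ e' : Fin n → ℕ, ∀ i j : Fin n, (∀ w, e' w + I i w = e w + I j w) →
      Even (Mdeg e') := by
    intro e' i j h
    have h2 := sum_congr rfl (fun w (_ : w ∈ univ) => h w)
    rw [sum_add_distrib, sum_add_distrib, sum_I, sum_I] at h2
    have : Mdeg e' = Mdeg e := by unfold Mdeg; omega
    rw [this]; exact hev
  by_cases hp : ∃ i, d i < e i
  · by_cases hq : ∃ j, e j < d j
    · obtain ⟨i, hi⟩ := hp
      obtain ⟨j, hj⟩ := hq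
      have h : ∀ w, (e w + I j w - I i w) + I i w = e w + I j w := by
        intro w
        rcases I_cases i w with ⟨rfl, h1⟩ | ⟨_, h1⟩ <;> omega
      have hds : l1dist (fun w => e w + I j w - I i w) d + 2 = l1dist e d := by
        refine dist_step _ _ _ i j fun w => ?_
        have := h w
        rcases I_cases i w with ⟨h0, h1⟩ | ⟨h0, h1⟩ <;> rcases I_cases j w with ⟨h3, h2⟩ | ⟨h3, h2⟩
        · subst h0; subst h3; omega
        · subst h0; simp only [h1, h2]; omega
        · subst h3; simp only [h1, h2]; omega
        · simp only [h1, h2]; omega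
      exact ⟨_, hds, evn1 _ i j h, fin _ hds ((op1 e _ i j (by omega) h).trans (by omega))⟩
    · push Not at hq
      obtain ⟨i, j, hij⟩ := two_units e d hq hp hev hd
      have h : ∀ w, (e w - I i w - I j w) + I i w + I j w = e w := by
        intro w; have := hij w; omega
      have hds : l1dist (fun w => e w - I i w - I j w) d + 2 = l1dist e d := by
        refine dist_step _ _ _ i j fun w => ?_
        have := hij w
        omega
      refine ⟨_, hds, evn2 _ i j h, fin _ hds (op2 e _ i j ?_ ?_ ?_ h)⟩
      · have := hij i; rw [I_self] at this; omega
      · have := hij j; rw [I_self] at this; omega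
      · rintro rfl; have := hij i; rw [I_self] at this; omega
  · push Not at hp
    have hq : ∃ j, e j < d j := by
      by_contra hq
      push Not at hq
      exact hne (funext fun i => le_antisymm (hp i) (hq i))
    obtain ⟨i, j, hij⟩ := two_units d e hp hq hd hev
    have hds : l1dist (fun w => e w + I i w + I j w) d + 2 = l1dist e d := by
      refine dist_step _ _ _ i j fun w => ?_
      have := hij w
      omega
    exact ⟨_, hds, evn _ i j (fun _ => rfl),
      fin _ hds ((op3 e _ i j (fun _ => rfl)).trans (by omega))⟩

lemma iter {n : ℕ} {d : Fin n → ℕ} {Δ K : ℕ} (H : Hyp d Δ K) (hd : Even (Mdeg d)) :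
    ∀ k, k ≤ 4 → ∀ e : Fin n → ℕ, l1dist e d ≤ 2 * k → Even (Mdeg e) →
      (OmF e).card ≤ (Mdeg d) ^ (2 * k) * (OmF d).card := by
  have hM : 57 ≤ Mdeg d := by have := H.2.2; omega
  intro k
  induction k with
  | zero =>
    intro _ e he hev
    by_cases hne : e = d
    · subst hne; simp
    · obtain ⟨e', h1, _⟩ := step H hd e (by omega) hev hne
      omega
  | succ k ih =>
    intro hk e he hev
    by_cases hne : e = d
    · subst hne
      exact Nat.le_mul_of_pos_left _ (by positivity)
    · obtain ⟨e', h1, h2, h3⟩ := step H hd e (by omega) hev hne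
      have h4 := ih (by omega) e' (by omega) h2
      calc _ ≤ _ := h3
        _ ≤ (Mdeg d) ^ 2 * ((Mdeg d) ^ (2 * k) * (OmF d).card) := Nat.mul_le_mul_left _ h4
        _ = _ := by ring

lemma stable_of_hyp {n : ℕ} {d : Fin n → ℕ} {Δ K : ℕ} (H : Hyp d Δ K) (hd : Graphical d) :
    Stable 8 8 d := by
  intro d' ⟨G', hG'⟩ hdist
  obtain ⟨G, hG⟩ := hd
  have := iter H (even_sum G hG) 4 le_rfl d' hdist (even_sum G' hG')
  rw [card_OmF, card_OmF]
  have h8 : ((Mdeg d : ℝ)) ^ (8 : ℝ) = (Mdeg d : ℝ) ^ (8 : ℕ) := by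
    rw [← Real.rpow_natCast]; norm_num
  rw [h8]
  exact_mod_cast this

end BR

/-- bi-regular degree sequences, Theorem 5.4: a bi-regular
graphical degree sequence satisfying condition (a) or (b) is `(8,8)`-stable. -/
theorem stmt_9 {n : ℕ} (d : Fin n → ℕ) (hd : Graphical d) (δ Δ : ℕ) (hδΔ : δ ≤ Δ)
    (hval : ∀ i, d i = δ ∨ d i = Δ)
    (ℓ : ℕ) (hℓ : ℓ = ({i : Fin n | d i = Δ} : Set (Fin n)).ncard)
    (h : (Δ ≤ ℓ ∧ Δ * ℓ + (n - ℓ) * δ > 2 * Δ ^ 2 + 18 * Δ + 56) ∨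
         (ℓ < Δ ∧ n * δ > (Δ - δ) * ℓ + 2 * δ * Δ + 18 * Δ + 56)) :
    Stable 8 8 d := by
  classical
  set L : Finset (Fin n) := univ.filter (fun i => d i = Δ) with hL
  have hℓL : ℓ = L.card := by
    rw [hℓ, ← Set.ncard_coe_finset]; congr 1; ext i; simp [hL]
  have hle : ∀ i, d i ≤ Δ := fun i => by rcases hval i with h | h <;> omega
  have hℓn : ℓ ≤ n := by rw [hℓL]; exact (card_le_univ L).trans (by simp)
  have hd' : ∀ i, d i = δ + if i ∈ L then Δ - δ else 0 := by
    intro i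
    by_cases hi : d i = Δ
    · simp [hL, hi]; omega
    · simp only [hL, mem_filter, mem_univ, true_and, hi, if_false]
      rcases hval i with h | h
      · omega
      · exact absurd h hi
  have hS : ∀ S : Finset (Fin n), ∑ u ∈ S, d u = S.card * δ + (S ∩ L).card * (Δ - δ) := by
    intro S
    rw [sum_congr rfl (fun i _ => hd' i), sum_add_distrib, sum_const, smul_eq_mul,
      ← sum_filter, sum_const, smul_eq_mul, filter_mem_eq_inter]
  have hM : Mdeg d = n * δ + ℓ * (Δ - δ) := by
    unfold Mdeg; rw [hS]; simp [hℓL]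
  obtain ⟨c, rfl⟩ := Nat.exists_eq_add_of_le hδΔ
  obtain ⟨m, rfl⟩ := Nat.exists_eq_add_of_le hℓn
  simp only [Nat.add_sub_cancel_left] at *
  rcases h with ⟨h1, h2⟩ | ⟨h1, h2⟩
  · refine BR.stable_of_hyp (Δ := δ + c) (K := (δ + c + 9) * (δ + c)) ⟨hle, ?_, ?_⟩ hd
    · intro S hScard
      refine (sum_le_card_nsmul S d (δ + c) (fun i _ => hle i)).trans ?_
      rw [smul_eq_mul]
      exact Nat.mul_le_mul_right _ hScard
    · rw [hM]; nlinarith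
  · refine BR.stable_of_hyp (Δ := δ + c) (K := (δ + c + 9) * δ + ℓ * c) ⟨hle, ?_, ?_⟩ hd
    · intro S hScard
      rw [hS]
      refine Nat.add_le_add (Nat.mul_le_mul_right _ hScard) (Nat.mul_le_mul_right _ ?_)
      exact (card_le_card inter_subset_right).trans hℓL.ge
    · rw [hM]; nlinarith
end

section
/- For all real numbers C > 0 and γ > 2 there exists N such that for every n ≥ N the following holds: if d is a nontrivial graphical degree sequence of length n such that, for every integer i ≥ 1, the number of indices j with d_j = i is at most C·i^{−γ}·n, then d is (8,8)-stable. -/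
open Finset

lemma degOf_add_edge {n : ℕ} (G : SimpleGraph (Fin n)) (a b : Fin n) (hab : a ≠ b)
    (h : ¬ G.Adj a b) :
    degOf (G ⊔ SimpleGraph.edge a b) = degOf G + Pi.single a 1 + Pi.single b 1 := by
  funext i
  unfold degOf
  by_cases hia : i = a
  · subst hia
    have : (G ⊔ SimpleGraph.edge i b).neighborSet i = insert b (G.neighborSet i) := by
      ext j
      simp only [SimpleGraph.mem_neighborSet, SimpleGraph.sup_adj, SimpleGraph.edge_adj,
        Set.mem_insert_iff]
      grind
    rw [this, Set.ncard_insert_of_notMem (by simpa using h) (Set.toFinite _)]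
    simp [hab]
  · by_cases hib : i = b
    · subst hib
      have : (G ⊔ SimpleGraph.edge a i).neighborSet i = insert a (G.neighborSet i) := by
        ext j
        simp only [SimpleGraph.mem_neighborSet, SimpleGraph.sup_adj, SimpleGraph.edge_adj,
          Set.mem_insert_iff]
        grind
      rw [this, Set.ncard_insert_of_notMem (by simpa [G.adj_comm] using h) (Set.toFinite _)]
      simp [hia]
    · have : (G ⊔ SimpleGraph.edge a b).neighborSet i = G.neighborSet i := by
        ext j
        simp only [SimpleGraph.mem_neighborSet, SimpleGraph.sup_adj, SimpleGraph.edge_adj]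
        grind
      rw [this]
      simp [hia, hib]

lemma degOf_del_edge {n : ℕ} (G : SimpleGraph (Fin n)) (a b : Fin n) (h : G.Adj a b) :
    degOf G = degOf (G \ SimpleGraph.edge a b) + Pi.single a 1 + Pi.single b 1 := by
  rw [← degOf_add_edge _ a b h.ne (by simp [SimpleGraph.edge_adj, h.ne])]
  congr 1
  ext x y
  simp only [SimpleGraph.sup_adj, SimpleGraph.sdiff_adj, SimpleGraph.edge_adj]
  have := G.adj_comm a b
  grind

open Classical in
/-- Finset version of neighbours. -/
noncomputable def nbF {n : ℕ} (G : SimpleGraph (Fin n)) (i : Fin n) : Finset (Fin n) :=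
  Finset.univ.filter (fun j => G.Adj i j)

lemma nbF_card {n : ℕ} (G : SimpleGraph (Fin n)) (i : Fin n) : (nbF G i).card = degOf G i := by
  classical
  unfold degOf nbF
  rw [← Set.ncard_coe_finset]
  congr 1
  ext j
  simp

lemma mem_nbF {n : ℕ} (G : SimpleGraph (Fin n)) (i j : Fin n) : j ∈ nbF G i ↔ G.Adj i j := by
  classical
  simp [nbF]

/-- Finset version of Omega. -/
noncomputable def OmF {n : ℕ} (c : Fin n → ℕ) : Finset (SimpleGraph (Fin n)) :=
  (Omega c).toFinite.toFinset

lemma mem_OmF {n : ℕ} (c : Fin n → ℕ) (G : SimpleGraph (Fin n)) : G ∈ OmF c ↔ degOf G = c := by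
  simp [OmF, Omega, funext_iff]

lemma OmF_card {n : ℕ} (c : Fin n → ℕ) : (OmF c).card = (Omega c).ncard := by
  rw [OmF, Set.ncard_eq_toFinset_card]

open Classical in
/-- Good ordered edges. -/
noncomputable def goodF {n : ℕ} (G : SimpleGraph (Fin n)) (p q : Fin n) :
    Finset (Σ _ : Fin n, Fin n) :=
  (Finset.univ.sigma (fun x => nbF G x)).filter
    (fun z => (z.1 ≠ p ∧ z.1 ≠ q ∧ ¬ G.Adj p z.1) ∧ (z.2 ≠ q ∧ ¬ G.Adj q z.2))

lemma goodF_card {n : ℕ} (G : SimpleGraph (Fin n)) (p q : Fin n) (D : ℕ)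
    (hD : ∀ i, degOf G i ≤ D) :
    ∑ i, degOf G i ≤ (goodF G p q).card + (D + 2) * D + (D + 1) * D := by
  classical
  set A : Finset (Fin n) := insert p (insert q (nbF G p)) with hA
  set B : Finset (Fin n) := insert q (nbF G q) with hB
  have hAc : A.card ≤ D + 2 := by
    have h1 := Finset.card_insert_le p (insert q (nbF G p))
    have h2 := Finset.card_insert_le q (nbF G p)
    have h3 := nbF_card G p
    have h4 := hD p
    rw [hA]
    omega
  have hBc : B.card ≤ D + 1 := by
    have h2 := Finset.card_insert_le q (nbF G q)
    have h3 := nbF_card G q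
    have h4 := hD q
    rw [hB]
    omega
  have key : ∀ S : Finset (Fin n), (S.sigma (fun x => nbF G x)).card ≤ S.card * D := by
    intro S
    rw [Finset.card_sigma]
    exact Finset.sum_le_card_nsmul _ _ _ (fun x _ => by rw [nbF_card]; exact hD x)
  have h1 : (Finset.univ.sigma (fun x => nbF G x)).card = ∑ i, degOf G i := by
    rw [Finset.card_sigma]
    exact Finset.sum_congr rfl (fun x _ => nbF_card G x)
  have hsub : Finset.univ.sigma (fun x => nbF G x) ⊆
      (goodF G p q ∪ A.sigma (fun x => nbF G x)) ∪
        (B.sigma (fun x => nbF G x)).image (fun z => (⟨z.2, z.1⟩ : Σ _ : Fin n, Fin n)) := by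
    rintro ⟨x, y⟩ h
    have hxy : G.Adj x y := by simpa [mem_nbF] using h
    simp only [Finset.mem_union, Finset.mem_image, goodF, Finset.mem_filter, h, true_and]
    by_cases hx : x ∈ A
    · left; right; simp [hx, mem_nbF, hxy]
    · by_cases hy : y ∈ B
      · right
        exact ⟨⟨y, x⟩, by simp [hy, mem_nbF, hxy.symm], rfl⟩
      · left; left
        simp only [hA, hB, Finset.mem_insert, mem_nbF, not_or] at hx hy
        exact ⟨hx, hy⟩
  rw [← h1]
  have h2 := Finset.card_le_card hsub
  have h3 := Finset.card_union_le (goodF G p q ∪ A.sigma (fun x => nbF G x))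
    ((B.sigma (fun x => nbF G x)).image (fun z => (⟨z.2, z.1⟩ : Σ _ : Fin n, Fin n)))
  have h4 := Finset.card_union_le (goodF G p q) (A.sigma (fun x => nbF G x))
  have h5 := Finset.card_image_le (s := B.sigma (fun x => nbF G x))
    (f := fun z => (⟨z.2, z.1⟩ : Σ _ : Fin n, Fin n))
  have h6 := key A
  have h7 := key B
  have h8 : A.card * D ≤ (D + 2) * D := Nat.mul_le_mul_right _ hAc
  have h9 : B.card * D ≤ (D + 1) * D := Nat.mul_le_mul_right _ hBc
  omega

lemma step_add {n : ℕ} (c : Fin n → ℕ) (p q : Fin n) (D : ℕ)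
    (hD : ∀ i, (c + Pi.single p 1 + Pi.single q 1 : Fin n → ℕ) i ≤ D) (hDpos : 1 ≤ D)
    (hM : D * D + (D + 2) * D + (D + 1) * D ≤ ∑ i, c i) :
    (OmF c).card ≤ (OmF (c + Pi.single p 1 + Pi.single q 1)).card := by
  classical
  set e := c + Pi.single p 1 + Pi.single q 1 with he
  have hcD : ∀ i, c i ≤ D := fun i => by
    refine le_trans ?_ (hD i)
    simp only [he, Pi.add_apply]; omega
  have hS : (OmF c).card * (D * D) ≤ ((OmF c).sigma (fun G => goodF G p q)).card := by
    rw [Finset.card_sigma]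
    refine Finset.card_nsmul_le_sum _ _ _ (fun G hG => ?_)
    rw [mem_OmF] at hG
    have := goodF_card G p q D (by rw [hG]; exact hcD)
    rw [hG] at this
    omega
  have hT : ((OmF e).sigma (fun H => (nbF H p).sigma (fun _ => nbF H q))).card
      ≤ (OmF e).card * (D * D) := by
    rw [Finset.card_sigma]
    refine Finset.sum_le_card_nsmul _ _ _ (fun H hH => ?_)
    rw [mem_OmF] at hH
    rw [Finset.card_sigma, Finset.sum_const, nbF_card, nbF_card, hH]
    exact Nat.mul_le_mul (hD p) (hD q)
  have hST : ((OmF c).sigma (fun G => goodF G p q)).card ≤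
      ((OmF e).sigma (fun H => (nbF H p).sigma (fun _ => nbF H q))).card := by
    refine Finset.card_le_card_of_injOn
      (fun z => ⟨((z.1 \ SimpleGraph.edge z.2.1 z.2.2) ⊔ SimpleGraph.edge p z.2.1) ⊔
        SimpleGraph.edge q z.2.2, z.2⟩) ?_ ?_
    · rintro ⟨G, x, y⟩ hz
      simp only [Finset.mem_coe, Finset.mem_sigma, mem_OmF, goodF, Finset.mem_filter, mem_nbF,
        Finset.mem_univ, true_and] at hz ⊢
      obtain ⟨hG, hxy, ⟨hxp, hxq, hpx⟩, hyq, hqy⟩ := hz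
      have hne := hxy.ne
      refine ⟨?_, ?_, ?_⟩
      · rw [degOf_add_edge _ q y (Ne.symm hyq), degOf_add_edge _ p x (Ne.symm hxp)]
        · have h1 := degOf_del_edge G x y hxy
          rw [hG] at h1
          rw [he, h1]
          abel
        · simp [hpx]
        · simp only [SimpleGraph.sup_adj, SimpleGraph.sdiff_adj, SimpleGraph.edge_adj]
          grind
      · simp only [SimpleGraph.sup_adj, SimpleGraph.sdiff_adj, SimpleGraph.edge_adj]
        grind
      · simp only [SimpleGraph.sup_adj, SimpleGraph.sdiff_adj, SimpleGraph.edge_adj]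
        grind
    · rintro ⟨G, x, y⟩ hz ⟨G', x', y'⟩ hz' heq
      simp only [Finset.mem_coe, Finset.mem_sigma, mem_OmF, goodF, Finset.mem_filter, mem_nbF,
        Finset.mem_univ, true_and] at hz hz'
      simp only [Sigma.mk.injEq, heq_eq_eq] at heq
      obtain ⟨hH, rfl, rfl⟩ := heq
      obtain ⟨-, hxy, ⟨hxp, hxq, hpx⟩, hyq, hqy⟩ := hz
      obtain ⟨-, hxy', ⟨-, -, hpx'⟩, -, hqy'⟩ := hz'
      have : G = G' := by
        ext a b
        have h1 := congrArg (fun K : SimpleGraph (Fin n) => K.Adj a b) hH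
        simp only [SimpleGraph.sup_adj, SimpleGraph.sdiff_adj, SimpleGraph.edge_adj] at h1
        have := G.adj_comm a b
        have := G'.adj_comm a b
        by_cases hab : a = b
        · subst hab; simp
        · by_cases c1 : (a = x ∧ b = y) ∨ (a = y ∧ b = x)
          · rcases c1 with ⟨rfl, rfl⟩ | ⟨rfl, rfl⟩ <;> grind
          · by_cases c2 : (a = p ∧ b = x) ∨ (a = x ∧ b = p)
            · rcases c2 with ⟨rfl, rfl⟩ | ⟨rfl, rfl⟩ <;> grind
            · by_cases c3 : (a = q ∧ b = y) ∨ (a = y ∧ b = q)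
              · rcases c3 with ⟨rfl, rfl⟩ | ⟨rfl, rfl⟩ <;> grind
              · grind
      subst this
      rfl
  have hDD : 0 < D * D := Nat.mul_pos hDpos hDpos
  exact Nat.le_of_mul_le_mul_right (hS.trans (hST.trans hT)) hDD

lemma even_sum_degOf {n : ℕ} (G : SimpleGraph (Fin n)) : Even (∑ i, degOf G i) := by
  classical
  have h := G.sum_degrees_eq_twice_card_edges
  have : ∑ i, degOf G i = ∑ i, G.degree i := by
    refine Finset.sum_congr rfl (fun i _ => ?_)
    rw [degOf, Set.ncard_eq_toFinset_card']
    rfl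
  rw [this, h]
  exact even_two_mul _

lemma stage_add {n : ℕ} (d : Fin n → ℕ) (D : ℕ) (hd : Graphical d) (hD : ∀ i, d i ≤ D)
    (hDpos : 1 ≤ D) (hM : D * D + (D + 2) * D + (D + 1) * D + 8 ≤ ∑ i, d i) (k : ℕ) :
    ∀ c : Fin n → ℕ, (∀ i, c i ≤ d i) → ∑ i, d i = ∑ i, c i + k → k ≤ 8 →
      (OmF c).card ≤ (OmF d).card := by
  classical
  induction k using Nat.strong_induction_on with
  | _ k ih =>
    intro c hc hk hk8
    rcases (OmF c).eq_empty_or_nonempty with h0 | ⟨G, hG⟩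
    · simp [h0]
    rw [mem_OmF] at hG
    obtain ⟨G', hG'⟩ := hd
    have e1 := even_sum_degOf G
    have e2 := even_sum_degOf G'
    have hG'' : degOf G' = d := funext hG'
    rw [hG] at e1
    rw [hG''] at e2
    have pick : ∀ c' : Fin n → ℕ, (∀ i, c' i ≤ d i) → ∑ i, c' i < ∑ i, d i →
        ∃ p, ∀ i, (c' + Pi.single p 1 : Fin n → ℕ) i ≤ d i := by
      intro c' h1 h2
      obtain ⟨p, -, hp⟩ := Finset.exists_lt_of_sum_lt h2
      refine ⟨p, fun i => ?_⟩
      by_cases hi : i = p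
      · subst hi; simp; omega
      · simp [hi, h1 i]
    have ssum : ∀ (c' : Fin n → ℕ) (p : Fin n), ∑ i, (c' + Pi.single p 1 : Fin n → ℕ) i = ∑ i, c' i + 1 := by
      intro c' p
      simp [Finset.sum_add_distrib]
    rcases Nat.eq_zero_or_pos k with rfl | hkpos
    · have : c = d := by
        funext i
        exact (Finset.sum_eq_sum_iff_of_le (fun i _ => hc i)).1 (by omega) i (Finset.mem_univ i)
      rw [this]
    · obtain ⟨a, ha⟩ := e1
      obtain ⟨b, hb⟩ := e2
      obtain ⟨p, hp⟩ := pick c hc (by omega)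
      have s1 := ssum c p
      obtain ⟨q, hq⟩ := pick _ hp (by omega)
      have s2 := ssum (c + Pi.single p 1) q
      refine (step_add c p q D (fun i => (hq i).trans (hD i)) hDpos (by omega)).trans ?_
      exact ih (k - 2) (by omega) _ hq (by omega) (by omega)

lemma del_bound {n : ℕ} (c : Fin n → ℕ) (u : Fin n) (hu : 0 < c u) (K : ℕ)
    (hK : ∀ w c', c = c' + Pi.single u 1 + Pi.single w 1 → (OmF c').card ≤ K) :
    (OmF c).card ≤ n * K := by
  classical
  have hT : ((OmF c).filter (fun G => True)).card = (OmF c).card := by simp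
  have hsub : OmF c ⊆ Finset.univ.biUnion (fun w => (OmF c).filter (fun G => G.Adj u w)) := by
    intro G hG
    have h1 := hG
    rw [mem_OmF] at h1
    have : 0 < (nbF G u).card := by rw [nbF_card, h1]; exact hu
    obtain ⟨w, hw⟩ := Finset.card_pos.1 this
    rw [mem_nbF] at hw
    simp only [Finset.mem_biUnion, Finset.mem_univ, true_and, Finset.mem_filter]
    exact ⟨w, hG, hw⟩
  refine (Finset.card_le_card hsub).trans (Finset.card_biUnion_le.trans ?_)
  have : ∀ w ∈ (Finset.univ : Finset (Fin n)),
      ((OmF c).filter (fun G => G.Adj u w)).card ≤ K := by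
    intro w _
    rcases ((OmF c).filter (fun G => G.Adj u w)).eq_empty_or_nonempty with h0 | ⟨G, hG⟩
    · simp [h0]
    rw [Finset.mem_filter, mem_OmF] at hG
    have hc := degOf_del_edge G u w hG.2
    rw [hG.1] at hc
    refine le_trans ?_ (hK w _ hc)
    refine Finset.card_le_card_of_injOn (fun G => G \ SimpleGraph.edge u w) ?_ ?_
    · intro G2 hG2
      simp only [Finset.mem_coe, Finset.mem_filter, mem_OmF] at hG2 ⊢
      have hc2 := degOf_del_edge G2 u w hG2.2
      rw [hG2.1, hc] at hc2
      simpa using hc2.symm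
    · intro G1 h1 G2 h2 h
      simp only [Finset.mem_coe, Finset.mem_filter] at h1 h2
      ext a b
      have h3 := congrArg (fun K : SimpleGraph (Fin n) => K.Adj a b) h
      simp only [SimpleGraph.sdiff_adj, SimpleGraph.edge_adj] at h3
      have := h1.2.symm
      have := h2.2.symm
      have := h1.2
      have := h2.2
      by_cases c1 : (a = u ∧ b = w) ∨ (a = w ∧ b = u)
      · rcases c1 with ⟨rfl, rfl⟩ | ⟨rfl, rfl⟩ <;> grind
      · grind
  simpa using Finset.sum_le_card_nsmul _ _ _ this

lemma stage_del {n : ℕ} (d : Fin n → ℕ) (D : ℕ) (hd : Graphical d) (hD : ∀ i, d i ≤ D)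
    (hDpos : 1 ≤ D) (hM : D * D + (D + 2) * D + (D + 1) * D + 8 ≤ ∑ i, d i) (s : ℕ) :
    ∀ c : Fin n → ℕ, ∑ i, (c i - d i) ≤ s → ∑ i, (c i - d i) + ∑ i, (d i - c i) ≤ 8 →
      (OmF c).card ≤ n ^ s * (OmF d).card := by
  classical
  induction s with
  | zero =>
    intro c h1 h2
    have hc : ∀ i, c i ≤ d i := by
      intro i
      have h3 : ∑ i, (c i - d i) = 0 := by omega
      have := (Finset.sum_eq_zero_iff.1 h3) i (Finset.mem_univ i)
      omega
    have h3 : ∑ i, d i = ∑ i, c i + ∑ i, (d i - c i) := by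
      rw [← Finset.sum_add_distrib]
      exact Finset.sum_congr rfl (fun i _ => by have := hc i; omega)
    simpa using stage_add d D hd hD hDpos hM _ c hc h3 (by omega)
  | succ s ih =>
    intro c h1 h2
    by_cases h : ∃ u, d u < c u
    · obtain ⟨u, hu⟩ := h
      rw [pow_succ', mul_assoc]
      refine del_bound c u (by omega) _ (fun w c' hc' => ih c' ?_ ?_)
      · have : ∑ i, (c' i - d i) < ∑ i, (c i - d i) := by
          refine Finset.sum_lt_sum (fun i _ => ?_) ⟨u, Finset.mem_univ u, ?_⟩
          · have := congrFun hc' i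
            simp only [Pi.add_apply] at this
            omega
          · have := congrFun hc' u
            simp only [Pi.add_apply, Pi.single_eq_same] at this
            omega
        omega
      · have : ∑ i, (c' i - d i) + ∑ i, (d i - c' i) + 1 ≤
            ∑ i, (c i - d i) + ∑ i, (d i - c i) + 1 := by
          have hs : ∀ v : Fin n, ∑ i, (Pi.single v 1 : Fin n → ℕ) i = 1 := by
            intro v; simp
          have key : ∑ i, ((c' i - d i) + (d i - c' i) + (Pi.single u 1 : Fin n → ℕ) i) ≤
              ∑ i, ((c i - d i) + (d i - c i) + (Pi.single w 1 : Fin n → ℕ) i) := by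
            refine Finset.sum_le_sum (fun i _ => ?_)
            have := congrFun hc' i
            simp only [Pi.add_apply] at this
            by_cases hi : i = u
            · subst hi
              simp only [Pi.single_eq_same] at this ⊢
              by_cases hw : i = w
              · subst hw
                simp only [Pi.single_eq_same] at this ⊢
                omega
              · simp only [Pi.single_eq_of_ne hw] at this ⊢
                omega
            · simp only [Pi.single_eq_of_ne hi] at this ⊢
              omega
          simp only [Finset.sum_add_distrib, hs] at key
          exact key
        omega
    · push Not at h
      have h0 : ∑ i, (c i - d i) = 0 :=
        Finset.sum_eq_zero (fun i _ => by have := h i; omega)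
      have h3 := ih c (by omega) h2
      refine h3.trans (Nat.mul_le_mul_right _ ?_)
      rcases Nat.eq_zero_or_pos n with rfl | hn
      · simp at hM
      · exact Nat.pow_le_pow_right hn (Nat.le_succ s)


lemma real_bound (C γ : ℝ) (hC : 0 < C) (hγ : 2 < γ) :
    ∃ N : ℕ, 1 ≤ N ∧ ∀ n : ℕ, N ≤ n → ∀ D : ℕ, 1 ≤ D → (1 : ℝ) ≤ C * (D : ℝ) ^ (-γ) * n →
      7 * (D * D) + 8 ≤ n := by
  obtain ⟨N, hN⟩ := exists_nat_ge (15 * ((15 * C) ^ (1 / (γ - 2))) ^ 2)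
  refine ⟨N + 1, by omega, fun n hn D hD h => ?_⟩
  by_contra hcon
  push Not at hcon
  have hD1 : (1 : ℝ) ≤ D := by exact_mod_cast hD
  have hD0 : (0 : ℝ) < D := by linarith
  have h1 : (n : ℝ) < 15 * (D : ℝ) ^ 2 := by
    have : (n : ℝ) < 7 * (D * D) + 8 := by exact_mod_cast hcon
    nlinarith
  have h2 : (D : ℝ) ^ γ ≤ C * n := by
    rw [Real.rpow_neg hD0.le] at h
    have hp : 0 < (D : ℝ) ^ γ := Real.rpow_pos_of_pos hD0 _
    have : C * ((D : ℝ) ^ γ)⁻¹ * n = C * n / (D : ℝ) ^ γ := by field_simp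
    rw [this, le_div_iff₀ hp] at h
    linarith
  have h3 : (D : ℝ) ^ γ = (D : ℝ) ^ (γ - 2) * (D : ℝ) ^ 2 := by
    rw [← Real.rpow_natCast, ← Real.rpow_add hD0]
    norm_num
  have h4 : (D : ℝ) ^ (γ - 2) ≤ 15 * C := by
    have hp : 0 < (D : ℝ) ^ 2 := by positivity
    refine le_of_mul_le_mul_right ?_ hp
    nlinarith
  have h5 : (D : ℝ) ≤ (15 * C) ^ (1 / (γ - 2)) := by
    have h6 := Real.rpow_le_rpow (by positivity) h4
      (show (0 : ℝ) ≤ 1 / (γ - 2) from by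
        apply one_div_nonneg.2; linarith)
    rwa [← Real.rpow_mul hD0.le, mul_one_div_cancel (by linarith), Real.rpow_one] at h6
  have h7 : (D : ℝ) ^ 2 ≤ ((15 * C) ^ (1 / (γ - 2))) ^ 2 := by gcongr
  have h8 : (N : ℝ) + 1 ≤ n := by exact_mod_cast hn
  linarith

/-- Theorem 5.2: nontrivial power-law density-bounded degree
sequences with parameter `γ > 2` are `(8,8)`-stable for all large enough `n`. -/
theorem stmt_10 (C γ : ℝ) (hC : 0 < C) (hγ : 2 < γ) :
    ∃ N : ℕ, ∀ n : ℕ, N ≤ n → ∀ d : Fin n → ℕ, Graphical d → (∀ j, 1 ≤ d j) →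
      (∀ i : ℕ, 1 ≤ i →
        (({j : Fin n | d j = i} : Set (Fin n)).ncard : ℝ) ≤ C * (i : ℝ) ^ (-γ) * n) →
      Stable 8 8 d := by
  obtain ⟨N, hN1, hN⟩ := real_bound C γ hC hγ
  refine ⟨N, fun n hn d hd hpos hden d' hd' hdist => ?_⟩
  have hn0 : 0 < n := by omega
  haveI : NeZero n := ⟨by omega⟩
  obtain ⟨j, hj⟩ : ∃ j, ∀ i, d i ≤ d j := Finite.exists_max d
  have hone : (1 : ℝ) ≤ (({k : Fin n | d k = d j} : Set (Fin n)).ncard : ℝ) := by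
    have : 0 < ({k : Fin n | d k = d j} : Set (Fin n)).ncard :=
      (Set.ncard_pos (Set.toFinite _)).2 ⟨j, rfl⟩
    exact_mod_cast this
  have hb := hN n hn (d j) (hpos j) (hone.trans (hden (d j) (hpos j)))
  have hMn : n ≤ ∑ i, d i := by
    have := Finset.card_nsmul_le_sum Finset.univ d 1 (fun i _ => hpos i)
    simpa using this
  have hsum : ∑ i, (d' i - d i) + ∑ i, (d i - d' i) ≤ 8 := by
    rw [← Finset.sum_add_distrib]
    refine le_trans (Finset.sum_le_sum (fun i _ => ?_)) hdist
    omega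
  have hDj := hpos j
  have main := stage_del d (d j) hd hj hDj (by nlinarith) 8 d' (by omega) hsum
  rw [OmF_card, OmF_card] at main
  have main2 : ((Omega d').ncard : ℝ) ≤ (n : ℝ) ^ 8 * ((Omega d).ncard : ℝ) := by
    exact_mod_cast main
  have h8 : (Mdeg d : ℝ) ^ (8 : ℝ) = (Mdeg d : ℝ) ^ 8 := by
    rw [← Real.rpow_natCast]; norm_num
  rw [h8]
  refine main2.trans ?_
  have : (n : ℝ) ≤ (Mdeg d : ℝ) := by exact_mod_cast hMn
  gcongr
end
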